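/- Let η > 0 and let H be a graph with hcf(H) = 1 and chromatic number χ(H) =: r ≥ 2. Let σ := σ(H), h := |H| and ω := (h − σ)/(r − 1). Then there exists an integer n₁ = n₁(η, H) such that the following holds: if G is a graph on n ≥ n₁ vertices such that h divides n and G has degree sequence d₁ ≤ d₂ ≤ … ≤ d_n satisfying d_i ≥ (1 − (ω + σ)/h)·n + (σ/ω)·i + ηn for all 1 ≤ i ≤ ωn/h, then G contains a perfect H-tiling. -/

import Mathlib

open SimpleGraph

/-- The degree of a vertex, as the cardinality of its neighbour set. -/
noncomputable def degN {V : Type*} (G : SimpleGraph V) (v : V) : ℕ :=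
  (G.neighborSet v).ncard

/-- `f` is a copy of `H` in `G`: an injective map preserving adjacency. -/
def IsCopy {α β : Type*} (H : SimpleGraph α) (G : SimpleGraph β) (f : α → β) : Prop :=
  Function.Injective f ∧ ∀ ⦃u v : α⦄, H.Adj u v → G.Adj (f u) (f v)

/-- An `H`-tiling in `G`: a collection of vertex-disjoint copies of `H` in `G`. -/
def IsTiling {α β : Type*} (H : SimpleGraph α) (G : SimpleGraph β) (T : Set (α → β)) : Prop :=
  (∀ f ∈ T, IsCopy H G f) ∧
    T.Pairwise fun f g => Disjoint (Set.range f) (Set.range g)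

/-- `G` contains a perfect `H`-tiling. -/
def HasPerfectTiling {α β : Type*} (H : SimpleGraph α) (G : SimpleGraph β) : Prop :=
  ∃ T : Set (α → β), IsTiling H G T ∧ ∀ v : β, ∃ f ∈ T, v ∈ Set.range f

/-- `σ(H)` relative to `r` colours: the smallest possible size of a colour class in
any proper colouring of `H` with `r` colours. -/
noncomputable def minClassSize {α : Type*} (H : SimpleGraph α) (r : ℕ) : ℕ :=
  sInf {s : ℕ | ∃ (c : H.Coloring (Fin r)) (i : Fin r), s = {v | c v = i}.ncard}

/-- `hcf_χ(H) = 1`: the highest common factor of all differences of colour class sizes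
over optimal colourings is 1 (equivalently, no `d ≥ 2` divides all such differences). -/
def HcfChiOne {α : Type*} (H : SimpleGraph α) (r : ℕ) : Prop :=
  ∀ d : ℕ, 2 ≤ d →
    ¬ ∀ (c : H.Coloring (Fin r)) (i j : Fin r),
        (d : ℤ) ∣ (({v | c v = i}.ncard : ℤ) - ({v | c v = j}.ncard : ℤ))

/-- `hcf_χ(H) ≤ 2`: some difference of colour class sizes is nonzero (so `hcf_χ(H) ≠ ∞`)
and no `d ≥ 3` divides all such differences. -/
def HcfChiLeTwo {α : Type*} (H : SimpleGraph α) (r : ℕ) : Prop :=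
  (∃ (c : H.Coloring (Fin r)) (i j : Fin r),
      {v | c v = i}.ncard ≠ {v | c v = j}.ncard) ∧
    ∀ d : ℕ, 3 ≤ d →
      ¬ ∀ (c : H.Coloring (Fin r)) (i j : Fin r),
          (d : ℤ) ∣ (({v | c v = i}.ncard : ℤ) - ({v | c v = j}.ncard : ℤ))

/-- `hcf_c(H) = 1`: the highest common factor of the orders of the components of `H` is 1. -/
def HcfCompOne {α : Type*} (H : SimpleGraph α) : Prop :=
  ∀ d : ℕ, 2 ≤ d → ∃ C : H.ConnectedComponent, ¬ d ∣ C.supp.ncard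

/-- `hcf(H) = 1` for a graph `H` with `χ(H) = r`. -/
def HcfOne {α : Type*} (H : SimpleGraph α) (r : ℕ) : Prop :=
  (r = 2 → HcfCompOne H ∧ HcfChiLeTwo H 2) ∧ (r ≠ 2 → HcfChiOne H r)

/-- **Erdős' theorem on complete partite subhypergraphs**, in the form of a dense set of tuples
containing a combinatorial grid whose sides are disjoint from each other and from a given small
set. -/
lemma exists_grid_of_dense (t M : ℕ) : ∀ (c : ℝ), 0 < c → ∀ y : ℕ, ∃ N₀ : ℕ, ∀ N ≥ N₀,
    ∀ E : Finset (Fin M → Fin N), c * (N : ℝ) ^ M ≤ E.card →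
    ∀ Y : Finset (Fin N), Y.card ≤ y →
    ∃ X : Fin M → Finset (Fin N), (∀ a, (X a).card = t) ∧ (∀ a, Disjoint (X a) Y) ∧
      (Pairwise fun a b => Disjoint (X a) (X b)) ∧
        ∀ f : Fin M → Fin N, (∀ a, f a ∈ X a) → f ∈ E := by
  classical
  induction M with
  | zero =>
    intro c hc y
    refine ⟨0, fun N _ E hE Y _ => ⟨fun a => a.elim0, fun a => a.elim0, fun a => a.elim0,
      fun a => a.elim0, fun f _ => ?_⟩⟩
    have : 0 < E.card := by
      have : (0 : ℝ) < E.card := lt_of_lt_of_le (by positivity) hE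
      exact_mod_cast this
    obtain ⟨g, hg⟩ := Finset.card_pos.mp this
    rwa [Subsingleton.elim f g]
  | succ M ih =>
    intro c hc y
    obtain ⟨L, hL⟩ := exists_nat_ge ((t : ℝ) / (c / 4))
    have hLt : (t : ℝ) ≤ c / 4 * (L + 1 : ℕ) := by
      rw [div_le_iff₀ (by positivity)] at hL
      push_cast
      nlinarith
    set L' := L + 1 with hL'
    obtain ⟨N₁, hN₁⟩ := ih (c / 4 / 2 ^ L') (by positivity) (y + t)
    obtain ⟨N₂, hN₂⟩ := exists_nat_ge (((L' : ℝ) + y) / (c / 2))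
    refine ⟨max N₁ (N₂ + 1), fun N hN E hE Y hY => ?_⟩
    have hNN₁ : N₁ ≤ N := le_trans (le_max_left _ _) hN
    have hNN₂ : N₂ + 1 ≤ N := le_trans (le_max_right _ _) hN
    have hNpos : (0 : ℝ) < N := by exact_mod_cast (by omega : 0 < N)
    have hNbig : (L' : ℝ) + y ≤ c / 2 * N := by
      rw [div_le_iff₀ (by positivity)] at hN₂
      have : (N₂ : ℝ) ≤ N := by exact_mod_cast (by omega : N₂ ≤ N)
      nlinarith
    let Ex : Fin N → Finset (Fin M → Fin N) := fun x => Finset.univ.filter fun g =>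
      (Fin.cons x g : Fin (M + 1) → Fin N) ∈ E
    have hcard : E.card = ∑ x, (Ex x).card := by
      rw [← Finset.card_sigma]
      refine Finset.card_bij' (fun f _ => (⟨f 0, Fin.tail f⟩ : Σ _ : Fin N, (Fin M → Fin N)))
        (fun p _ => (Fin.cons p.1 p.2 : Fin (M + 1) → Fin N)) ?_ ?_ ?_ ?_
      · intro f hf; simp [Ex, hf]
      · rintro ⟨x, g⟩ hp; simpa [Ex] using hp
      · intro f hf; simp
      · rintro ⟨x, g⟩ hp; simp
    have hExle : ∀ x, ((Ex x).card : ℝ) ≤ (N : ℝ) ^ M := by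
      intro x
      have := Finset.card_le_univ (Ex x)
      simp only [Fintype.card_fun, Fintype.card_fin] at this
      exact_mod_cast this
    let good : Finset (Fin N) := Finset.univ.filter fun x => c / 2 * (N : ℝ) ^ M ≤ (Ex x).card
    have hgood : c / 2 * N ≤ good.card := by
      have h1 : (E.card : ℝ) ≤ good.card * (N : ℝ) ^ M + N * (c / 2 * (N : ℝ) ^ M) := by
        rw [hcard]
        push_cast
        calc ∑ x, ((Ex x).card : ℝ)
            ≤ ∑ x, ((if x ∈ good then (N : ℝ) ^ M else 0) + c / 2 * (N : ℝ) ^ M) := by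
              refine Finset.sum_le_sum fun x _ => ?_
              split_ifs with hx
              · have := hExle x
                have : 0 ≤ c / 2 * (N : ℝ) ^ M := by positivity
                linarith [hExle x]
              · simp only [good, Finset.mem_filter, Finset.mem_univ, true_and, not_le] at hx
                linarith
          _ = _ := by
              rw [Finset.sum_add_distrib, ← Finset.sum_filter]
              simp
      have h2 : 0 < (N : ℝ) ^ M := by positivity
      rw [pow_succ] at hE
      have h3 : c / 2 * N * (N : ℝ) ^ M ≤ good.card * (N : ℝ) ^ M := by nlinarith
      exact le_of_mul_le_mul_right h3 h2
    have hgoodY : L' ≤ (good \ Y).card := by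
      have h1 := Finset.le_card_sdiff Y good
      have h2 : (L' + y : ℝ) ≤ good.card := hNbig.trans hgood
      have h3 : L' + y ≤ good.card := by exact_mod_cast h2
      omega
    obtain ⟨S, hSsub, hScard⟩ := Finset.exists_subset_card_eq hgoodY
    let Sg : (Fin M → Fin N) → Finset (Fin N) := fun g => S.filter fun x => g ∈ Ex x
    have hsum : c / 2 * L' * (N : ℝ) ^ M ≤ ∑ g, ((Sg g).card : ℝ) := by
      have h1 : ∑ g, (Sg g).card = ∑ x ∈ S, (Ex x).card := by
        simp only [Sg, Finset.card_filter]
        rw [Finset.sum_comm]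
        refine Finset.sum_congr rfl fun x _ => ?_
        simp
      have h2 : (∑ g, ((Sg g).card : ℝ)) = ∑ x ∈ S, ((Ex x).card : ℝ) := by exact_mod_cast h1
      rw [h2]
      calc c / 2 * L' * (N : ℝ) ^ M = ∑ x ∈ S, c / 2 * (N : ℝ) ^ M := by
            rw [Finset.sum_const, hScard]; simp; ring
        _ ≤ _ := Finset.sum_le_sum fun x hx => by
            have := hSsub hx
            simp only [good, Finset.mem_sdiff, Finset.mem_filter, Finset.mem_univ, true_and] at this
            exact this.1
    let big : Finset (Fin M → Fin N) := Finset.univ.filter fun g => t ≤ (Sg g).card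
    have hbig : c / 4 * (N : ℝ) ^ M ≤ big.card := by
      have h1 : ∑ g, ((Sg g).card : ℝ) ≤ big.card * L' + t * (N : ℝ) ^ M := by
        calc ∑ g, ((Sg g).card : ℝ)
            ≤ ∑ g, ((if g ∈ big then (L' : ℝ) else 0) + t) := by
              refine Finset.sum_le_sum fun g _ => ?_
              split_ifs with hg
              · have : (Sg g).card ≤ L' := hScard ▸ Finset.card_filter_le _ _
                have : ((Sg g).card : ℝ) ≤ L' := by exact_mod_cast this
                have : (0 : ℝ) ≤ t := by positivity
                linarith
              · simp only [big, Finset.mem_filter, Finset.mem_univ, true_and, not_le] at hg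
                have : ((Sg g).card : ℝ) ≤ t := by exact_mod_cast hg.le
                linarith
          _ = _ := by
              rw [Finset.sum_add_distrib, ← Finset.sum_filter]
              simp
              ring
      have h2 : (0 : ℝ) < L' := by positivity
      have h3 : 0 < (N : ℝ) ^ M := by positivity
      have h4 : c / 4 * (N : ℝ) ^ M * L' ≤ big.card * L' := by nlinarith
      exact le_of_mul_le_mul_right h4 h2
    obtain ⟨P, hP, hPcard⟩ := Finset.exists_le_card_fiber_of_nsmul_le_card_of_maps_to
      (s := big) (t := S.powerset) (f := Sg) (b := (c / 4 / 2 ^ L' * (N : ℝ) ^ M))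
      (fun g _ => Finset.mem_powerset.mpr (Finset.filter_subset _ _)) ⟨∅, by simp⟩ (by
        rw [nsmul_eq_mul, Finset.card_powerset, hScard]
        refine le_trans (le_of_eq ?_) hbig
        push_cast
        field_simp)
    have hPne : (big.filter fun g => Sg g = P).Nonempty := by
      rw [← Finset.card_pos]
      have : (0 : ℝ) < (big.filter fun g => Sg g = P).card := lt_of_lt_of_le (by positivity) hPcard
      exact_mod_cast this
    obtain ⟨g₀, hg₀⟩ := hPne
    have htP : t ≤ P.card := by
      simp only [big, Finset.mem_filter, Finset.mem_univ, true_and] at hg₀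
      rw [← hg₀.2]; exact hg₀.1
    obtain ⟨P', hP'sub, hP'card⟩ := Finset.exists_subset_card_eq htP
    obtain ⟨X, hX1, hX2, hX3, hX4⟩ := hN₁ N hNN₁ _ hPcard (Y ∪ P') (by
      refine (Finset.card_union_le _ _).trans ?_
      omega)
    refine ⟨Fin.cons P' X, ?_, ?_, ?_, ?_⟩
    · intro a
      refine Fin.cases ?_ (fun b => ?_) a
      · simpa using hP'card
      · simpa using hX1 b
    · intro a
      refine Fin.cases ?_ (fun b => ?_) a
      · simp only [Fin.cons_zero]
        rw [Finset.disjoint_left]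
        intro x hx
        have h1 := hSsub (Finset.mem_powerset.mp hP (hP'sub hx))
        exact (Finset.mem_sdiff.mp h1).2
      · simp only [Fin.cons_succ]
        exact Finset.disjoint_of_subset_right Finset.subset_union_left (hX2 b)
    · intro a b
      refine Fin.cases ?_ (fun a => ?_) a <;> refine Fin.cases ?_ (fun b => ?_) b
      · simp
      · intro _
        simp only [Fin.cons_zero, Fin.cons_succ]
        exact (Finset.disjoint_of_subset_right Finset.subset_union_right (hX2 b)).symm
      · intro _
        simp only [Fin.cons_zero, Fin.cons_succ]
        exact (Finset.disjoint_of_subset_right Finset.subset_union_right (hX2 a))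
      · intro hab
        simp only [Fin.cons_succ]
        exact hX3 (fun h => hab (by rw [h]))
    · intro f hf
      have h0 := hf 0
      have htail : Fin.tail f ∈ big.filter fun g => Sg g = P :=
        hX4 _ fun a => by simpa [Fin.tail] using hf a.succ
      rw [Finset.mem_filter] at htail
      have h1 : f 0 ∈ Sg (Fin.tail f) := by
        rw [htail.2]; exact hP'sub (by simpa using h0)
      simpa [Sg, Ex] using (Finset.mem_filter.mp h1).2

/-- Summing a function of tuples that has mean zero in one coordinate gives zero. -/
lemma sum_tuples_eq_zero {M N : ℕ} (F : (Fin M → Fin N) → ℝ) (c : Fin M)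
    (hF : ∀ f, ∑ j, F (Function.update f c j) = 0) : ∑ f, F f = 0 := by
  classical
  rcases Nat.eq_zero_or_pos N with rfl | hN
  · exact Fintype.sum_eq_zero _ fun f => (f c).elim0
  have h1 : ∑ f : Fin M → Fin N, ∑ j, F (Function.update f c j) = N * ∑ f, F f := by
    have h2 : ∑ p : (Fin M → Fin N) × Fin N, F (Function.update p.1 c p.2) =
        ∑ p : (Fin M → Fin N) × Fin N, F p.1 := by
      let e : (Fin M → Fin N) × Fin N → (Fin M → Fin N) × Fin N :=
        fun p => (Function.update p.1 c p.2, p.1 c)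
      have he : Function.Involutive e := fun p => by
        ext <;> simp [e]
      exact Fintype.sum_equiv he.toPerm _ _ fun p => rfl
    rw [Fintype.sum_prod_type, Fintype.sum_prod_type] at h2
    rw [h2]
    simp [Finset.mul_sum]
  simp only [hF, Finset.sum_const_zero] at h1
  have hN' : (N : ℝ) ≠ 0 := by positivity
  simpa [hN'] using h1.symm

/-- A tuple `f` extended by a further fixed entry `i₀`. -/
def extendTuple {M N : ℕ} (i₀ : Fin N) (f : Fin M → Fin N) (p : Option (Fin M)) : Fin N :=
  p.elim i₀ f

/-- Second moment bound for the sum over a random tuple of a mean-zero function depending on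
one entry of the extended tuple. -/
lemma sum_sq_sample_le {M N : ℕ} (g : Fin N → Fin N → ℝ) (B : ℝ) (hB : ∀ i j, |g i j| ≤ B)
    (hg : ∀ i, ∑ j, g i j = 0) (i₀ : Fin N) (p : Option (Fin M)) :
    ∑ f : Fin M → Fin N, (∑ b, g (extendTuple i₀ f p) (f b)) ^ 2 ≤ M * B ^ 2 * (N : ℝ) ^ M := by
  classical
  have hoff : ∀ b c : Fin M, c ≠ b → some c ≠ p →
      ∑ f : Fin M → Fin N, g (extendTuple i₀ f p) (f b) * g (extendTuple i₀ f p) (f c) = 0 := by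
    intro b c hcb hcp
    refine sum_tuples_eq_zero _ c fun f => ?_
    have h1 : ∀ j, extendTuple i₀ (Function.update f c j) p = extendTuple i₀ f p := by
      intro j
      cases p with
      | none => rfl
      | some a =>
        have : a ≠ c := fun h => hcp (by rw [h])
        simp [extendTuple, this]
    simp only [h1, Function.update_self, Function.update_of_ne hcb.symm]
    rw [← Finset.mul_sum, hg, mul_zero]
  have hpair : ∀ b c : Fin M,
      ∑ f : Fin M → Fin N, g (extendTuple i₀ f p) (f b) * g (extendTuple i₀ f p) (f c) ≤
        if b = c then B ^ 2 * (N : ℝ) ^ M else 0 := by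
    intro b c
    split_ifs with hbc
    · subst hbc
      calc _ ≤ ∑ f : Fin M → Fin N, B ^ 2 := by
            refine Finset.sum_le_sum fun f _ => ?_
            rw [← sq]
            exact sq_le_sq' (by linarith [(abs_le.mp (hB (extendTuple i₀ f p) (f b))).1])
              (abs_le.mp (hB _ _)).2
        _ = _ := by simp; ring
    · by_cases hcp : some c = p
      · have hbp : some b ≠ p := by
          rw [← hcp]; simpa using hbc
        have := hoff c b hbc hbp
        refine le_of_eq (Eq.trans (Finset.sum_congr rfl fun f _ => mul_comm _ _) this)
      · exact le_of_eq (hoff b c (Ne.symm hbc) hcp)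
  calc _ = ∑ b, ∑ c, ∑ f : Fin M → Fin N,
          g (extendTuple i₀ f p) (f b) * g (extendTuple i₀ f p) (f c) := by
        simp only [sq, Finset.sum_mul_sum]
        rw [Finset.sum_comm]
        refine Finset.sum_congr rfl fun b _ => Finset.sum_comm
    _ ≤ ∑ b : Fin M, ∑ c : Fin M, (if b = c then B ^ 2 * (N : ℝ) ^ M else 0) :=
        Finset.sum_le_sum fun b _ => Finset.sum_le_sum fun c _ => hpair b c
    _ = _ := by simp; ring

/-- For a random tuple `f`, all but at most `K` of the entries of the extended tuple (and never the
fixed one) see sample sums close to their mean. -/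
lemma card_good_tuples_ge {J : Type*} [Fintype J] {M N : ℕ} (g : J → Fin N → Fin N → ℝ) (B : ℝ)
    (hB : ∀ q i j, |g q i j| ≤ B) (hg : ∀ q i, ∑ j, g q i j = 0) (i₀ : Fin N)
    (δ : ℝ) (hδ : 0 < δ) (K : ℕ) (hK : 4 * Fintype.card J * B ^ 2 / δ ^ 2 ≤ K + 1) (hM : K + 1 ≤ M)
    (good : Finset (Fin M → Fin N))
    (hgood : ∀ f : Fin M → Fin N, ∀ A : Finset (Fin M), M ≤ A.card + K →
      (∀ q, ∀ p : Option (Fin M), (∀ a, p = some a → a ∈ A) →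
        |∑ b, g q (extendTuple i₀ f p) (f b)| ≤ δ * M) → f ∈ good) :
    1 / 2 * (N : ℝ) ^ M ≤ good.card := by
  classical
  have hMpos : (0 : ℝ) < M := by exact_mod_cast (by omega : 0 < M)
  let S : J → (Fin M → Fin N) → Option (Fin M) → ℝ := fun q f p =>
    ∑ b, g q (extendTuple i₀ f p) (f b)
  let w : Option (Fin M) → ℝ := fun p => p.elim (M : ℝ) (fun _ => 1)
  have hw : ∀ p, 0 ≤ w p := by
    rintro (_ | a)
    · exact hMpos.le
    · exact zero_le_one
  have hwsum : ∑ p, w p = 2 * M := by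
    rw [Fintype.sum_option]; simp [w]; ring
  let Φ : (Fin M → Fin N) → ℝ := fun f => ∑ p, w p * ∑ q, S q f p ^ 2
  have hΦ : ∑ f, Φ f ≤ 2 * M * (Fintype.card J * (M * B ^ 2 * (N : ℝ) ^ M)) := by
    calc ∑ f, Φ f = ∑ p, w p * ∑ q, ∑ f, S q f p ^ 2 := by
          simp only [Φ]
          rw [Finset.sum_comm]
          refine Finset.sum_congr rfl fun p _ => ?_
          rw [← Finset.mul_sum, Finset.sum_comm]
      _ ≤ ∑ p, w p * (Fintype.card J * (M * B ^ 2 * (N : ℝ) ^ M)) := by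
          refine Finset.sum_le_sum fun p _ => mul_le_mul_of_nonneg_left ?_ (hw p)
          calc ∑ q, ∑ f, S q f p ^ 2 ≤ ∑ _q : J, (M * B ^ 2 * (N : ℝ) ^ M) :=
                Finset.sum_le_sum fun q _ => sum_sq_sample_le (g q) B (hB q) (hg q) i₀ p
            _ = _ := by simp
      _ = _ := by rw [← Finset.sum_mul, hwsum]
  have hbad : ∀ f, f ∉ good → (K + 1 : ℝ) * (δ * M) ^ 2 ≤ Φ f := by
    intro f hf
    have hterm : ∀ p, (∃ q, δ * M < |S q f p|) → (δ * M) ^ 2 ≤ ∑ q, S q f p ^ 2 := by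
      rintro p ⟨q, hq⟩
      refine le_trans ?_ (Finset.single_le_sum (fun q _ => sq_nonneg (S q f p))
        (Finset.mem_univ q))
      rw [← sq_abs (S q f p)]
      exact pow_le_pow_left₀ (by positivity) hq.le 2
    have hnn : ∀ p, 0 ≤ w p * ∑ q, S q f p ^ 2 := fun p =>
      mul_nonneg (hw p) (Finset.sum_nonneg fun q _ => sq_nonneg _)
    by_cases h0 : ∃ q, δ * M < |S q f none|
    · calc (K + 1 : ℝ) * (δ * M) ^ 2 ≤ M * (δ * M) ^ 2 := by
            have : (K + 1 : ℝ) ≤ M := by exact_mod_cast hM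
            gcongr
        _ ≤ w none * ∑ q, S q f none ^ 2 := mul_le_mul_of_nonneg_left (hterm none h0) hMpos.le
        _ ≤ Φ f := Finset.single_le_sum (fun p _ => hnn p) (Finset.mem_univ none)
    · let A : Finset (Fin M) := Finset.univ.filter fun a => ¬ ∃ q, δ * M < |S q f (some a)|
      have hA : K + 1 ≤ Aᶜ.card := by
        by_contra hlt
        refine hf (hgood f A ?_ ?_)
        · have := Finset.card_add_card_compl A
          rw [Fintype.card_fin] at this
          omega
        · intro q p hp
          by_contra hc
          cases p with
          | none => exact h0 ⟨q, not_le.mp hc⟩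
          | some a =>
            have := hp a rfl
            simp only [A, Finset.mem_filter, Finset.mem_univ, true_and] at this
            exact this ⟨q, not_le.mp hc⟩
      calc (K + 1 : ℝ) * (δ * M) ^ 2 ≤ (Aᶜ.card : ℝ) * (δ * M) ^ 2 := by
            have : (K + 1 : ℝ) ≤ Aᶜ.card := by exact_mod_cast hA
            gcongr
        _ = ∑ a ∈ Aᶜ, (δ * M) ^ 2 := by simp
        _ ≤ ∑ a ∈ Aᶜ, w (some a) * ∑ q, S q f (some a) ^ 2 := by
            refine Finset.sum_le_sum fun a ha => ?_
            have h1 : ∃ q, δ * M < |S q f (some a)| := by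
              simpa [A] using ha
            simpa [w] using hterm _ h1
        _ ≤ ∑ a, w (some a) * ∑ q, S q f (some a) ^ 2 :=
            Finset.sum_le_sum_of_subset_of_nonneg (Finset.subset_univ _) fun a _ _ => hnn _
        _ ≤ Φ f := by
            simp only [Φ]
            rw [Fintype.sum_option]
            linarith [hnn none]
  have hbadcard : (goodᶜ.card : ℝ) * ((K + 1) * (δ * M) ^ 2) ≤ ∑ f, Φ f := by
    calc _ = ∑ f ∈ goodᶜ, ((K + 1 : ℝ) * (δ * M) ^ 2) := by simp
      _ ≤ ∑ f ∈ goodᶜ, Φ f := Finset.sum_le_sum fun f hf => hbad f (by simpa using hf)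
      _ ≤ _ := Finset.sum_le_sum_of_subset_of_nonneg (Finset.subset_univ _) fun f _ _ =>
          Finset.sum_nonneg fun p _ => mul_nonneg (hw p) (Finset.sum_nonneg fun q _ => sq_nonneg _)
  have htot : (good.card : ℝ) + goodᶜ.card = (N : ℝ) ^ M := by
    have := Finset.card_add_card_compl good
    simp only [Fintype.card_fun, Fintype.card_fin] at this
    exact_mod_cast this
  have hKδ : 4 * Fintype.card J * B ^ 2 ≤ (K + 1) * δ ^ 2 := by
    rwa [div_le_iff₀ (by positivity)] at hK
  have hfin : (goodᶜ.card : ℝ) * ((K + 1) * δ ^ 2) ≤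
      1 / 2 * (N : ℝ) ^ M * ((K + 1) * δ ^ 2) := by
    have h1 := hbadcard.trans hΦ
    have h2 : (goodᶜ.card : ℝ) * ((K + 1) * δ ^ 2) * (M : ℝ) ^ 2 ≤
        (2 * (Fintype.card J * B ^ 2) * (N : ℝ) ^ M) * (M : ℝ) ^ 2 := by
      nlinarith
    have h3 := le_of_mul_le_mul_right h2 (by positivity)
    have h4 : 0 ≤ (N : ℝ) ^ M := by positivity
    nlinarith
  have := le_of_mul_le_mul_right hfin (by positivity)
  linarith

/-- Nonnegative weighted least squares: a minimiser exists and satisfies the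
Karush-Kuhn-Tucker conditions. -/
lemma exists_nonneg_least_squares {ι κ : Type*} [Fintype ι] [Fintype κ] (A : ι → κ → ℝ)
    (hA : ∀ i k, 0 ≤ A i k) (hA' : ∀ i, ∃ k, 0 < A i k) (μ : κ → ℝ) (hμ : ∀ k, 0 < μ k)
    (b : κ → ℝ) :
    ∃ x : ι → ℝ, (∀ i, 0 ≤ x i) ∧
      (∀ i, ∑ k, A i k * (μ k * (b k - ∑ j, x j * A j k)) ≤ 0) ∧
      (∀ i, 0 < x i → ∑ k, A i k * (μ k * (b k - ∑ j, x j * A j k)) = 0) ∧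
      ∀ y : ι → ℝ, (∀ i, 0 ≤ y i) → ∑ k, μ k * (b k - ∑ j, x j * A j k) ^ 2 ≤
        ∑ k, μ k * (b k - ∑ j, y j * A j k) ^ 2 := by
  classical
  let F : (ι → ℝ) → ℝ := fun x => ∑ k, μ k * (b k - ∑ j, x j * A j k) ^ 2
  have hFc : Continuous F := by fun_prop
  have hF0 : 0 ≤ F 0 := Finset.sum_nonneg fun k _ => mul_nonneg (hμ k).le (sq_nonneg _)
  have hbd : ∀ i, ∃ C : ℝ, 0 ≤ C ∧ ∀ x : ι → ℝ, (∀ i, 0 ≤ x i) → F x ≤ F 0 → x i ≤ C := by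
    intro i
    obtain ⟨k, hk⟩ := hA' i
    have hs : 0 ≤ Real.sqrt (F 0 / μ k) := Real.sqrt_nonneg _
    refine ⟨(|b k| + Real.sqrt (F 0 / μ k)) / A i k, by positivity, fun x hx hFx => ?_⟩
    rw [le_div_iff₀ hk]
    have h1 : x i * A i k ≤ ∑ j, x j * A j k :=
      Finset.single_le_sum (f := fun j => x j * A j k)
        (fun j _ => mul_nonneg (hx j) (hA j k)) (Finset.mem_univ i)
    have h2 : μ k * (b k - ∑ j, x j * A j k) ^ 2 ≤ F 0 :=
      le_trans (Finset.single_le_sum (f := fun k => μ k * (b k - ∑ j, x j * A j k) ^ 2)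
        (fun k _ => mul_nonneg (hμ k).le (sq_nonneg _)) (Finset.mem_univ k)) hFx
    have h3 : |b k - ∑ j, x j * A j k| ≤ Real.sqrt (F 0 / μ k) := by
      apply Real.abs_le_sqrt
      rw [le_div_iff₀ (hμ k)]
      linarith
    have h4 := (abs_le.mp h3).1
    have h5 := le_abs_self (b k)
    linarith
  choose C hC0 hC using hbd
  obtain ⟨x, hxmem, hxmin⟩ := (isCompact_Icc : IsCompact (Set.Icc (0 : ι → ℝ) C)).exists_isMinOn
    ⟨0, ⟨le_rfl, hC0⟩⟩ hFc.continuousOn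
  have hx0 : ∀ i, 0 ≤ x i := hxmem.1
  have hmin : ∀ y : ι → ℝ, (∀ i, 0 ≤ y i) → F x ≤ F y := by
    intro y hy
    by_cases h : F y ≤ F 0
    · exact hxmin ⟨hy, fun i => hC i y hy h⟩
    · exact (hxmin (⟨le_rfl, hC0⟩ : (0 : ι → ℝ) ∈ Set.Icc (0 : ι → ℝ) C)).trans (not_le.mp h).le
  let p : ι → ℝ := fun i => ∑ k, A i k * (μ k * (b k - ∑ j, x j * A j k))
  let Q : ι → ℝ := fun i => ∑ k, μ k * A i k ^ 2
  have hQ : ∀ i, 0 ≤ Q i := fun i =>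
    Finset.sum_nonneg fun k _ => mul_nonneg (hμ k).le (sq_nonneg _)
  have hexp : ∀ i τ, F (x + Pi.single i τ) = F x - 2 * τ * p i + τ ^ 2 * Q i := by
    intro i τ
    simp only [F, p, Q, Finset.mul_sum, ← Finset.sum_sub_distrib, ← Finset.sum_add_distrib]
    refine Finset.sum_congr rfl fun k _ => ?_
    have : ∑ j, (x + Pi.single i τ : ι → ℝ) j * A j k = ∑ j, x j * A j k + τ * A i k := by
      simp only [Pi.add_apply, add_mul, Finset.sum_add_distrib]
      congr 1
      rw [Finset.sum_eq_single i] <;> simp +contextual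
    rw [this]
    ring
  have hvar : ∀ i τ, -x i ≤ τ → 0 ≤ τ ^ 2 * Q i - 2 * τ * p i := by
    intro i τ hτ
    have := hmin (x + Pi.single i τ) (fun j => by
      by_cases hj : j = i
      · subst hj; simp; linarith
      · simpa [hj] using hx0 j)
    rw [hexp] at this
    linarith
  have hle : ∀ i, p i ≤ 0 := by
    intro i
    by_contra hp
    push Not at hp
    have hQ1 : 0 < Q i + 1 := by linarith [hQ i]
    have h1 := hvar i (p i / (Q i + 1)) (by
      have := hx0 i
      have : 0 ≤ p i / (Q i + 1) := by positivity
      linarith)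
    have h2 : (p i / (Q i + 1)) ^ 2 * Q i - 2 * (p i / (Q i + 1)) * p i =
        - (p i ^ 2 * (Q i + 2) / (Q i + 1) ^ 2) := by
      field_simp
      ring
    have h3 : 0 < p i ^ 2 * (Q i + 2) / (Q i + 1) ^ 2 := by
      have := hQ i
      positivity
    linarith
  refine ⟨x, hx0, hle, fun i hi => le_antisymm (hle i) ?_, hmin⟩
  by_contra hp
  push Not at hp
  change p i < 0 at hp
  have hQ1 : 0 < Q i + 1 := by linarith [hQ i]
  set τ := min (x i) (-p i / (Q i + 1)) with hτ
  have hτ0 : 0 < τ := lt_min hi (div_pos (by linarith) hQ1)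
  have hτx : τ ≤ x i := min_le_left _ _
  have hτp : τ * (Q i + 1) ≤ -p i := by
    rw [← le_div_iff₀ hQ1]; exact min_le_right _ _
  have h1 := hvar i (-τ) (by linarith)
  nlinarith

/-- The weight of a position of an `r`-clique: `s` at the special position `i₀`, `o` elsewhere. -/
def cliqueWeight {r : ℕ} (i₀ : Fin r) (o s : ℝ) (i : Fin r) : ℝ := if i = i₀ then s else o

/-- Every nonempty set `Z` of vertices contains a vertex of degree at least
`((r - 2) o + η) n + min (s n) ((s / o) |Z|)`: the degree sequence condition in rescaled form. -/
def DegCond {W : Type*} [Fintype W] (R : SimpleGraph W) (r : ℕ) (o s η : ℝ) : Prop :=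
  ∀ Z : Finset W, Z.Nonempty → ∃ v ∈ Z,
    (((r : ℝ) - 2) * o + η) * Fintype.card W + min (s * Fintype.card W) (s / o * Z.card) ≤ degN R v

lemma degN_eq_card_filter {W : Type*} [Fintype W] (R : SimpleGraph W) (v : W)
    [DecidablePred (R.Adj v)] : degN R v = (Finset.univ.filter (R.Adj v)).card := by
  rw [degN, ← Set.ncard_coe_finset]
  congr 1
  ext w
  simp

lemma cliqueWeight_pos {r : ℕ} (i₀ : Fin r) {o s : ℝ} (hs : 0 < s) (hso : s ≤ o) (i : Fin r) :
    0 < cliqueWeight i₀ o s i := by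
  unfold cliqueWeight; split_ifs <;> linarith

lemma sum_cliqueWeight {r : ℕ} (i₀ : Fin r) (o s : ℝ) :
    ∑ i, cliqueWeight i₀ o s i = ((r : ℝ) - 1) * o + s := by
  unfold cliqueWeight
  rw [← Finset.add_sum_erase _ _ (Finset.mem_univ i₀), if_pos rfl,
    Finset.sum_congr rfl fun i hi => if_neg (Finset.ne_of_mem_erase hi)]
  have : 1 ≤ r := i₀.pos
  simp [Finset.card_erase_of_mem, this]
  ring

/-- Adjacency in `R` with a joker `none` adjacent to everything, itself included. -/
def JokerAdj {W : Type*} (R : SimpleGraph W) : Option W → Option W → Prop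
  | some v, some w => R.Adj v w
  | _, _ => True

/-- Cliques of size `r` in `R` in which jokers may be used. -/
def JokerClique {W : Type*} (R : SimpleGraph W) (r : ℕ) : Type _ :=
  {T : Fin r → Option W // ∀ i j, i ≠ j → JokerAdj R (T i) (T j)}

lemma JokerAdj.symm {W : Type*} {R : SimpleGraph W} {p q : Option W} (h : JokerAdj R p q) :
    JokerAdj R q p := by
  cases p <;> cases q <;> simp_all [JokerAdj, R.adj_comm]

/-- The total weight received by the vertex `k` in the clique `T`. -/
noncomputable def tileWeight {W : Type*} {r : ℕ} (ρ : Fin r → ℝ) (T : Fin r → Option W)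
    (k : Option W) : ℝ :=
  open Classical in ∑ i, if T i = k then ρ i else 0

lemma sum_tileWeight_mul {W : Type*} [Fintype W] {r : ℕ} (ρ : Fin r → ℝ) (T : Fin r → Option W)
    (φ : Option W → ℝ) : ∑ k, tileWeight ρ T k * φ k = ∑ i, ρ i * φ (T i) := by
  classical
  simp only [tileWeight, Finset.sum_mul]
  rw [Finset.sum_comm]
  refine Finset.sum_congr rfl fun i _ => ?_
  rw [Finset.sum_eq_single (T i)]
  · simp
  · intro k _ hk; simp [hk.symm]
  · simp

lemma tileWeight_nonneg {W : Type*} {r : ℕ} {ρ : Fin r → ℝ} (hρ : ∀ i, 0 < ρ i)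
    (T : Fin r → Option W) (k : Option W) : 0 ≤ tileWeight ρ T k := by
  classical
  refine Finset.sum_nonneg fun i _ => ?_
  split_ifs
  · exact (hρ i).le
  · exact le_rfl

lemma tileWeight_pos {W : Type*} {r : ℕ} {ρ : Fin r → ℝ} (hρ : ∀ i, 0 < ρ i)
    (T : Fin r → Option W) (i : Fin r) : 0 < tileWeight ρ T (T i) := by
  classical
  refine Finset.sum_pos' (fun i _ => ?_) ⟨i, Finset.mem_univ i, by simpa using hρ i⟩
  split_ifs
  · exact (hρ i).le
  · exact le_rfl

/-- In a tight clique, the positions not joined to a vertex of maximal price carry little of the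
unjoined weight that is not itself of maximal price. -/
lemma adj_weight_le {W : Type*} (R : SimpleGraph W) {r : ℕ} (i₀ : Fin r) {o s : ℝ}
    (hs : 0 < s) (hso : s ≤ o) (hsum : ((r : ℝ) - 1) * o + s = 1) (w : Option W → ℝ)
    (hw : ∀ T : JokerClique R r, ∑ i, cliqueWeight i₀ o s i * w (T.1 i) ≤ 0)
    (T : JokerClique R r) (hT : ∑ i, cliqueWeight i₀ o s i * w (T.1 i) = 0) (v : W)
    (hv0 : 0 < w (some v)) (hvmax : ∀ k, w k ≤ w (some v))
    (ad zz : Option W → ℝ) (had1 : ∀ k, JokerAdj R (some v) k → ad k = 1)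
    (had0 : ∀ k, ¬ JokerAdj R (some v) k → ad k = 0)
    (hz0 : ∀ k, 0 ≤ zz k) (hz1 : ∀ k, w k = w (some v) → zz k = 1) :
    ∑ i, cliqueWeight i₀ o s i * ad (T.1 i) ≤
        ((r : ℝ) - 2) * o + s / o * ∑ i, cliqueWeight i₀ o s i * zz (T.1 i) ∧
      ∑ i, cliqueWeight i₀ o s i * ad (T.1 i) ≤ ((r : ℝ) - 2) * o + s := by
  classical
  set ρ := cliqueWeight i₀ o s with hρdef
  have hρ : ∀ i, 0 < ρ i := cliqueWeight_pos i₀ hs hso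
  have hρsum : ∑ i, ρ i = 1 := (sum_cliqueWeight i₀ o s).trans hsum
  have ho : 0 < o := hs.trans_le hso
  have hnotall : ¬ ∀ i, w (T.1 i) = w (some v) := by
    intro h
    simp only [h, ← Finset.sum_mul, hρsum] at hT
    linarith
  have hrepl : ∀ i, (∀ j, j ≠ i → JokerAdj R (some v) (T.1 j)) → w (T.1 i) = w (some v) := by
    intro i hi
    have h1 := hw ⟨Function.update T.1 i (some v), fun j k hjk => by
      by_cases hj : j = i
      · subst hj
        rw [Function.update_self, Function.update_of_ne hjk.symm]
        exact hi k hjk.symm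
      · by_cases hk : k = i
        · subst hk
          rw [Function.update_self, Function.update_of_ne hj]
          exact (hi j hj).symm
        · rw [Function.update_of_ne hj, Function.update_of_ne hk]
          exact T.2 j k hjk⟩
    have h2 : ∑ j, ρ j * w (Function.update T.1 i (some v) j) =
        ∑ j, ρ j * w (T.1 j) + ρ i * (w (some v) - w (T.1 i)) := by
      rw [← Finset.add_sum_erase _ _ (Finset.mem_univ i),
        ← Finset.add_sum_erase (a := i) (f := fun j => ρ j * w (T.1 j)) _ (Finset.mem_univ i),
        Function.update_self,
        Finset.sum_congr rfl fun j hj => by rw [Function.update_of_ne (Finset.ne_of_mem_erase hj)]]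
      ring
    simp only [h2, hT] at h1
    have := hvmax (T.1 i)
    have h3 : w (some v) - w (T.1 i) ≤ 0 := by
      by_contra h
      push Not at h
      have := mul_pos (hρ i) h
      linarith
    linarith
  have hzsum : ∀ i, w (T.1 i) = w (some v) → ρ i ≤ ∑ i, ρ i * zz (T.1 i) := by
    intro i hi
    refine le_trans (le_of_eq ?_) (Finset.single_le_sum (f := fun i => ρ i * zz (T.1 i))
      (fun j _ => mul_nonneg (hρ j).le (hz0 _)) (Finset.mem_univ i))
    simp [hz1 _ hi]
  have hznn : 0 ≤ ∑ i, ρ i * zz (T.1 i) :=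
    Finset.sum_nonneg fun j _ => mul_nonneg (hρ j).le (hz0 _)
  have hadle : ∀ k, ad k ≤ 1 := fun k => by
    by_cases h : JokerAdj R (some v) k
    · rw [had1 k h]
    · rw [had0 k h]; exact zero_le_one
  have hsodiv : 0 < s / o := div_pos hs ho
  by_cases h2 : ∃ i j, i ≠ j ∧ ¬ JokerAdj R (some v) (T.1 i) ∧ ¬ JokerAdj R (some v) (T.1 j)
  · obtain ⟨i, j, hij, hi, hj⟩ := h2
    have h3 : ∑ k, ρ k * ad (T.1 k) ≤ 1 - ρ i - ρ j := by
      rw [← hρsum, ← Finset.add_sum_erase _ _ (Finset.mem_univ i),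
        ← Finset.add_sum_erase (a := i) (f := ρ) _ (Finset.mem_univ i),
        ← Finset.add_sum_erase _ _ (Finset.mem_erase.mpr ⟨hij.symm, Finset.mem_univ j⟩),
        ← Finset.add_sum_erase (a := j) (f := ρ) _
          (Finset.mem_erase.mpr ⟨hij.symm, Finset.mem_univ j⟩), had0 _ hi, had0 _ hj]
      have : ∑ x ∈ (Finset.univ.erase i).erase j, ρ x * ad (T.1 x) ≤
          ∑ x ∈ (Finset.univ.erase i).erase j, ρ x :=
        Finset.sum_le_sum fun x _ => mul_le_of_le_one_right (hρ x).le (hadle _)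
      linarith
    have h4 : s + o ≤ ρ i + ρ j := by
      simp only [hρdef, cliqueWeight]
      split_ifs with h1 h2
      · exact absurd (h1.trans h2.symm) hij
      · exact le_rfl
      · linarith
      · linarith
    have h5 := mul_nonneg hsodiv.le hznn
    constructor <;> nlinarith
  · push Not at h2
    have h3 : ∃ i, ¬ JokerAdj R (some v) (T.1 i) := by
      by_contra hall
      push Not at hall
      exact hnotall fun i => hrepl i fun j _ => hall j
    obtain ⟨i, hi⟩ := h3
    have hoth : ∀ j, j ≠ i → JokerAdj R (some v) (T.1 j) := fun j hj => h2 i j hj.symm hi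
    have hwi := hrepl i hoth
    have hadsum : ∑ k, ρ k * ad (T.1 k) = 1 - ρ i := by
      rw [← hρsum, ← Finset.add_sum_erase _ _ (Finset.mem_univ i),
        ← Finset.add_sum_erase (a := i) (f := ρ) _ (Finset.mem_univ i), had0 _ hi,
        Finset.sum_congr rfl fun j hj => by
          rw [had1 _ (hoth j (Finset.ne_of_mem_erase hj)), mul_one]]
      ring
    have hz := hzsum i hwi
    by_cases hi0 : i = i₀
    · have hρi : ρ i = s := by simp [hρdef, cliqueWeight, hi0]
      have hso' : s = o := by
        by_contra hne
        have hlt : s < o := lt_of_le_of_ne hso hne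
        refine hnotall fun j => ?_
        by_cases hj : j = i
        · rw [hj, hwi]
        have h1 := hw ⟨T.1 ∘ Equiv.swap i j, fun a b hab => T.2 _ _ (by simpa using hab)⟩
        have hρj : ρ j = o := by simp [hρdef, cliqueWeight, ← hi0, hj]
        have hjmem : j ∈ Finset.univ.erase i := Finset.mem_erase.mpr ⟨hj, Finset.mem_univ j⟩
        have h4 : ∑ k, ρ k * w (T.1 (Equiv.swap i j k)) =
            ∑ k, ρ k * w (T.1 k) + (o - s) * (w (T.1 i) - w (T.1 j)) := by
          rw [← Finset.add_sum_erase _ _ (Finset.mem_univ i),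
            ← Finset.add_sum_erase (a := i) (f := fun k => ρ k * w (T.1 k)) _
              (Finset.mem_univ i), ← Finset.add_sum_erase _ _ hjmem,
            ← Finset.add_sum_erase (a := j) (f := fun k => ρ k * w (T.1 k)) _ hjmem,
            Finset.sum_congr rfl fun k hk => by
              rw [Equiv.swap_apply_of_ne_of_ne (Finset.ne_of_mem_erase (Finset.mem_of_mem_erase hk))
                (Finset.ne_of_mem_erase hk)], Equiv.swap_apply_left, Equiv.swap_apply_right,
            hρi, hρj]
          ring
        simp only [Function.comp_apply, h4, hT, hwi] at h1
        have := hvmax (T.1 j)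
        have : 0 ≤ w (T.1 j) - w (some v) := by
          by_contra h
          push Not at h
          have := mul_pos (sub_pos.mpr hlt) (show 0 < w (some v) - w (T.1 j) by linarith)
          linarith
        linarith
      have h5 : s / o = 1 := by rw [hso', div_self ho.ne']
      rw [h5]
      constructor <;> linarith
    · have hρi : ρ i = o := by simp [hρdef, cliqueWeight, hi0]
      rw [hρi] at hz
      have h5 : s / o * o = s := by field_simp
      have h6 := mul_le_mul_of_nonneg_left hz hsodiv.le
      constructor <;> linarith

noncomputable instance {W : Type*} [Finite W] (R : SimpleGraph W) (r : ℕ) :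
    Fintype (JokerClique R r) :=
  have : Finite (JokerClique R r) := by unfold JokerClique; infer_instance
  Fintype.ofFinite _

/-- Cliques consisting of one vertex and jokers cover every target using few jokers. -/
lemma exists_joker_tiling {W : Type*} [Fintype W] (R : SimpleGraph W) {r : ℕ} (hr : 2 ≤ r)
    (i₀ : Fin r) {o s : ℝ} (hs : 0 < s) (hso : s ≤ o) (hsum : ((r : ℝ) - 1) * o + s = 1)
    (b : W → ℝ) (hb0 : ∀ v, 0 ≤ b v) :
    ∃ y : JokerClique R r → ℝ, (∀ T, 0 ≤ y T) ∧
      (∀ v, ∑ T, y T * tileWeight (cliqueWeight i₀ o s) T.1 (some v) = b v) ∧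
      0 ≤ ∑ T, y T * tileWeight (cliqueWeight i₀ o s) T.1 none ∧
      ∑ T, y T * tileWeight (cliqueWeight i₀ o s) T.1 none ≤ (∑ v, b v) / o := by
  classical
  have ho : 0 < o := hs.trans_le hso
  obtain ⟨i₁, hi₁⟩ : ∃ i₁ : Fin r, i₁ ≠ i₀ := by
    have : Nontrivial (Fin r) := Fin.nontrivial_iff_two_le.mpr hr
    exact exists_ne i₀
  have hρ : ∀ i, 0 < cliqueWeight i₀ o s i := cliqueWeight_pos i₀ hs hso
  have hρ₁ : cliqueWeight i₀ o s i₁ = o := by simp [cliqueWeight, hi₁]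
  let τ : W → JokerClique R r := fun v =>
    ⟨fun i => if i = i₁ then some v else none, fun i j hij => by
      dsimp only
      split_ifs with h1 h2
      · exact absurd (h1.trans h2.symm) hij
      all_goals trivial⟩
  let y : JokerClique R r → ℝ := fun T => ∑ v, if τ v = T then b v / o else 0
  have hy0 : ∀ T, 0 ≤ y T := fun T => Finset.sum_nonneg fun v _ => by
    split_ifs
    · exact div_nonneg (hb0 v) ho.le
    · exact le_rfl
  have hsum' : ∀ k, ∑ T, y T * tileWeight (cliqueWeight i₀ o s) T.1 k =
      ∑ v, b v / o * tileWeight (cliqueWeight i₀ o s) (τ v).1 k := by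
    intro k
    simp only [y, Finset.sum_mul]
    rw [Finset.sum_comm]
    refine Finset.sum_congr rfl fun v _ => ?_
    rw [Finset.sum_eq_single (τ v)]
    · simp
    · intro T _ hT; simp [hT.symm]
    · simp
  have hτ : ∀ v u, tileWeight (cliqueWeight i₀ o s) (τ v).1 (some u) = if v = u then o else 0 := by
    intro v u
    unfold tileWeight
    rw [Finset.sum_eq_single i₁]
    · simp [τ, hρ₁]
    · intro i _ hi; simp [τ, hi]
    · simp
  have hτn : ∀ v, tileWeight (cliqueWeight i₀ o s) (τ v).1 none ≤ 1 := by
    intro v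
    refine le_trans (Finset.sum_le_sum fun i _ => ?_) ((sum_cliqueWeight i₀ o s).trans hsum).le
    split_ifs
    · exact le_rfl
    · exact (hρ i).le
  refine ⟨y, hy0, fun v => ?_, Finset.sum_nonneg fun T _ =>
    mul_nonneg (hy0 T) (tileWeight_nonneg hρ _ _), ?_⟩
  · rw [hsum']
    simp only [hτ, mul_ite, mul_zero, Finset.sum_ite_eq', Finset.mem_univ, if_true]
    field_simp
  · rw [hsum', Finset.sum_div]
    exact Finset.sum_le_sum fun v _ =>
      mul_le_of_le_one_right (div_nonneg (hb0 v) ho.le) (hτn v)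

/-- If deviations are small, no vertex of maximal deviation can have large degree. -/
lemma joker_tiling_contra {m d o s η δ ε J S P z a : ℝ} (hm : 0 < m) (hd : d ≤ m)
    (hs : 0 < s) (hδ : 0 ≤ δ) (hε : ε = (η - δ) / 4) (hδη : δ < η)
    (hJ : 0 ≤ J) (hP0 : 0 ≤ P) (hPs : P + s ≤ 1) (hS : S ≤ (1 + ε) * m)
    (hdeg : (P + η) * m + min (s * m) (s / o * z) ≤ d)
    (ha : (1 - δ - ε) * d ≤ a) (h1 : J + a ≤ P * (J + S) + s / o * z)
    (h2 : J + a ≤ (P + s) * (J + S)) : False := by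
  have hε0 : 0 < ε := by linarith
  have e1 : (P + s) * J ≤ J := by nlinarith
  have e2 : P * J ≤ J := by nlinarith
  have e3 : (P + s) * S ≤ (P + s) * m + ε * m := by
    have := mul_le_mul_of_nonneg_left hS (show 0 ≤ P + s by linarith)
    have := mul_le_mul_of_nonneg_right hPs (show 0 ≤ ε * m by positivity)
    nlinarith
  have e4 : P * S ≤ P * m + ε * m := by
    have := mul_le_mul_of_nonneg_left hS hP0
    have := mul_le_mul_of_nonneg_right (show P ≤ 1 by linarith) (show 0 ≤ ε * m by positivity)
    nlinarith
  have e5 : (δ + ε) * d ≤ (δ + ε) * m := mul_le_mul_of_nonneg_left hd (by linarith)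
  have e6 : (δ + 2 * ε) * m < η * m := mul_lt_mul_of_pos_right (by linarith) hm
  rcases min_choice (s * m) (s / o * z) with h | h <;> rw [h] at hdeg <;> nlinarith

lemma exists_fractional_tiling {W : Type*} [Fintype W] (R : SimpleGraph W) {r : ℕ} (hr : 2 ≤ r)
    (i₀ : Fin r) {o s η δ : ℝ} (hs : 0 < s) (hso : s ≤ o) (hsum : ((r : ℝ) - 1) * o + s = 1)
    (hδ : 0 ≤ δ) (hδη : δ < η) (hδ1 : δ ≤ 1) (hR : DegCond R r o s η) (b : W → ℝ)
    (hb0 : ∀ v, 1 - δ ≤ b v) (hb1 : ∀ v, b v ≤ 1)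
    [Fintype ((⊤ : SimpleGraph (Fin r)) →g R)] [DecidableEq W] :
    ∃ x : ((⊤ : SimpleGraph (Fin r)) →g R) → ℝ, (∀ κ, 0 ≤ x κ) ∧
      ∀ w, ∑ κ, x κ * ∑ i, (if κ i = w then cliqueWeight i₀ o s i else 0) = b w := by
  classical
  have hr' : (2 : ℝ) ≤ r := by exact_mod_cast hr
  have ho : 0 < o := hs.trans_le hso
  have ho1 : o ≤ 1 := by nlinarith
  have hro : 0 ≤ ((r : ℝ) - 2) * o := mul_nonneg (by linarith) ho.le
  have hro1 : ((r : ℝ) - 2) * o + s ≤ 1 := by linarith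
  set ρ := cliqueWeight i₀ o s with hρdef
  have hρ : ∀ i, 0 < ρ i := cliqueWeight_pos i₀ hs hso
  have hρsum : ∑ i, ρ i = 1 := (sum_cliqueWeight i₀ o s).trans hsum
  set m : ℝ := (Fintype.card W : ℝ) with hm
  have hm0 : 0 ≤ m := Nat.cast_nonneg _
  set ε := (η - δ) / 4 with hε
  have hε0 : 0 < ε := by linarith
  set Mc := (m / (o * ε)) ^ 2 + 1 with hMc
  have hMc0 : 0 < Mc := by positivity
  let μ : Option W → ℝ := fun k => k.elim 1 fun _ => Mc
  let b' : Option W → ℝ := fun k => k.elim 0 b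
  obtain ⟨x, hx0, hkkt, hcs, hmin⟩ := exists_nonneg_least_squares
    (fun (T : JokerClique R r) k => tileWeight ρ T.1 k) (fun T k => tileWeight_nonneg hρ T.1 k)
    (fun T => ⟨T.1 i₀, tileWeight_pos hρ T.1 i₀⟩) μ
    (fun k => by cases k <;> simp [μ, hMc0]) b'
  set cov : Option W → ℝ := fun k => ∑ T, x T * tileWeight ρ T.1 k with hcov
  set w : Option W → ℝ := fun k => μ k * (b' k - cov k) with hwdef
  have hcov0 : ∀ k, 0 ≤ cov k := fun k =>
    Finset.sum_nonneg fun T _ => mul_nonneg (hx0 T) (tileWeight_nonneg hρ T.1 k)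
  have hsw : ∀ φ : Option W → ℝ, ∑ T, x T * ∑ i, ρ i * φ (T.1 i) = ∑ k, cov k * φ k := by
    intro φ
    simp only [hcov, Finset.sum_mul]
    rw [Finset.sum_comm]
    refine Finset.sum_congr rfl fun T _ => ?_
    rw [← sum_tileWeight_mul, Finset.mul_sum]
    exact Finset.sum_congr rfl fun k _ => by ring
  have hw : ∀ T : JokerClique R r, ∑ i, ρ i * w (T.1 i) ≤ 0 := fun T => by
    rw [← sum_tileWeight_mul]; exact hkkt T
  have hT0 : ∀ T : JokerClique R r, 0 < x T → ∑ i, ρ i * w (T.1 i) = 0 := fun T hT => by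
    rw [← sum_tileWeight_mul]; exact hcs T hT
  have hcomp : ∑ k, cov k * w k = 0 := by
    rw [← hsw]
    refine Finset.sum_eq_zero fun T _ => ?_
    rcases (hx0 T).eq_or_lt with h | h
    · rw [← h, zero_mul]
    · rw [hT0 T h, mul_zero]
  have hwn : w none = - cov none := by simp [hwdef, μ, b']
  have hwv : ∀ v, w (some v) = Mc * (b v - cov (some v)) := fun v => by simp [hwdef, μ, b']
  have hle : ∀ v, b v ≤ cov (some v) := by
    by_contra hcon
    push Not at hcon
    obtain ⟨u₀, hu₀⟩ := hcon
    have hm1 : 0 < m := by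
      rw [hm]; exact_mod_cast Fintype.card_pos_iff.mpr ⟨u₀⟩
    have hF : ∀ v, |b v - cov (some v)| ≤ ε := by
      intro v
      obtain ⟨y, hy0, hyb, hyn0, hyn⟩ := exists_joker_tiling R hr i₀ hs hso hsum b
        fun v => by linarith [hb0 v]
      simp only [← hρdef] at hyb hyn0 hyn
      have h1 : Mc * (b v - cov (some v)) ^ 2 ≤ (m / o) ^ 2 := by
        calc Mc * (b v - cov (some v)) ^ 2 = μ (some v) * (b' (some v) - cov (some v)) ^ 2 := by
              simp [μ, b']
          _ ≤ ∑ k, μ k * (b' k - cov k) ^ 2 :=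
            Finset.single_le_sum (f := fun k => μ k * (b' k - cov k) ^ 2)
              (fun k _ => mul_nonneg (by cases k <;> simp [μ, hMc0.le]) (sq_nonneg _))
              (Finset.mem_univ _)
          _ ≤ _ := hmin y hy0
          _ = (∑ T, y T * tileWeight ρ T.1 none) ^ 2 := by
            rw [Fintype.sum_option]
            simp [hyb, μ, b']
          _ ≤ (m / o) ^ 2 := by
            refine pow_le_pow_left₀ hyn0 (hyn.trans ?_) 2
            gcongr
            calc ∑ v, b v ≤ ∑ _v : W, (1 : ℝ) := Finset.sum_le_sum fun v _ => hb1 v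
              _ = m := by simp [hm]
      have h2 : (m / o) ^ 2 ≤ Mc * ε ^ 2 := by
        have : Mc * ε ^ 2 = (m / o) ^ 2 + ε ^ 2 := by
          rw [hMc]; field_simp
        nlinarith [sq_nonneg ε]
      exact abs_le_of_sq_le_sq (le_of_mul_le_mul_left (h1.trans h2) hMc0) hε0.le
    obtain ⟨v', -, hv'⟩ := Finset.exists_max_image Finset.univ (fun v => w (some v))
      ⟨u₀, Finset.mem_univ _⟩
    have hpos' : 0 < w (some v') := by
      refine lt_of_lt_of_le ?_ (hv' u₀ (Finset.mem_univ _))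
      rw [hwv]
      exact mul_pos hMc0 (by linarith)
    set Z : Finset W := Finset.univ.filter fun u => w (some u) = w (some v') with hZ
    obtain ⟨v, hvZ, hvdeg⟩ := hR Z ⟨v', by simp [hZ]⟩
    have hvv : w (some v) = w (some v') := by simpa [hZ] using hvZ
    have hv0 : 0 < w (some v) := hvv ▸ hpos'
    have hvmax : ∀ k, w k ≤ w (some v) := by
      rintro (_ | u)
      · rw [hwn]; linarith [hcov0 none]
      · rw [hvv]; exact hv' u (Finset.mem_univ _)
    have hadj := fun T hT => adj_weight_le R i₀ hs hso hsum w hw T hT v hv0 hvmax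
      (fun k => if JokerAdj R (some v) k then 1 else 0)
      (fun k => if w k = w (some v) then 1 else 0)
      (fun k hk => if_pos hk) (fun k hk => if_neg hk)
      (fun k => by split_ifs <;> norm_num) (fun k hk => if_pos hk)
    have htot : ∑ T, x T = cov none + ∑ u, cov (some u) := by
      have := hsw fun _ => 1
      simpa [hρsum, Fintype.sum_option] using this
    have hadsum : ∑ T, x T * ∑ i, ρ i * (if JokerAdj R (some v) (T.1 i) then 1 else 0) =
        cov none + ∑ u ∈ Finset.univ.filter (R.Adj v), cov (some u) := by
      rw [hsw fun k => if JokerAdj R (some v) k then 1 else 0, Fintype.sum_option,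
        Finset.sum_filter]
      congr 1
      · simp [JokerAdj]
      · refine Finset.sum_congr rfl fun u _ => ?_
        by_cases h : R.Adj v u <;> simp [JokerAdj, h]
    have hzsum : ∑ T, x T * ∑ i, ρ i * (if w (T.1 i) = w (some v) then 1 else 0) ≤ Z.card := by
      rw [hsw fun k => if w k = w (some v) then 1 else 0, Fintype.sum_option, if_neg
        (by rw [hwn]; linarith [hcov0 none])]
      simp only [mul_ite, mul_one, mul_zero, zero_add]
      rw [← Finset.sum_filter, hvv, Finset.card_eq_sum_ones, Nat.cast_sum]
      refine Finset.sum_le_sum fun u hu => ?_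
      have h1 : w (some u) = w (some v') := by simpa using hu
      rw [← h1, hwv] at hpos'
      have := pos_of_mul_pos_right hpos' hMc0.le
      have := hb1 u
      simp only [Nat.cast_one]
      linarith
    refine joker_tiling_contra (d := (degN R v : ℝ)) (J := cov none) (S := ∑ u, cov (some u))
      (z := Z.card) (a := ∑ u ∈ Finset.univ.filter (R.Adj v), cov (some u)) hm1 ?_ hs hδ hε hδη
      (hcov0 none) hro hro1 ?_ hvdeg ?_ ?_ ?_
    · rw [degN_eq_card_filter, hm]
      exact_mod_cast Finset.card_le_univ _
    · calc ∑ u, cov (some u) ≤ ∑ _u : W, (1 + ε) := Finset.sum_le_sum fun u _ => by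
            have := abs_le.mp (hF u)
            have := hb1 u
            linarith
        _ = (1 + ε) * m := by simp [hm]; ring
    · calc (1 - δ - ε) * (degN R v : ℝ) = ∑ u ∈ Finset.univ.filter (R.Adj v), (1 - δ - ε) := by
            rw [degN_eq_card_filter]; simp; ring
        _ ≤ _ := Finset.sum_le_sum fun u _ => by
            have := abs_le.mp (hF u)
            have := hb0 u
            linarith
    · rw [← hadsum, ← htot, Finset.mul_sum]
      have h1 : ∑ T, x T * ∑ i, ρ i * (if JokerAdj R (some v) (T.1 i) then 1 else 0) ≤
          ∑ T, (((r : ℝ) - 2) * o * x T +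
            s / o * (x T * ∑ i, ρ i * (if w (T.1 i) = w (some v) then 1 else 0))) := by
        refine Finset.sum_le_sum fun T _ => ?_
        rcases (hx0 T).eq_or_lt with h | h
        · simp [← h]
        · have := mul_le_mul_of_nonneg_left (hadj T (hT0 T h)).1 h.le
          linarith
      refine h1.trans ?_
      rw [Finset.sum_add_distrib, ← Finset.mul_sum, ← Finset.mul_sum (a := s / o)]
      gcongr
    · rw [← hadsum, ← htot, Finset.mul_sum]
      refine Finset.sum_le_sum fun T _ => ?_
      rcases (hx0 T).eq_or_lt with h | h
      · simp [← h]
      · have := mul_le_mul_of_nonneg_left (hadj T (hT0 T h)).2 h.le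
        linarith
  have hterm : ∀ v, cov (some v) * w (some v) ≤ 0 := fun v =>
    mul_nonpos_of_nonneg_of_nonpos (hcov0 _)
      (by rw [hwv]; exact mul_nonpos_of_nonneg_of_nonpos hMc0.le (by linarith [hle v]))
  rw [Fintype.sum_option, hwn] at hcomp
  have hJ : cov none = 0 := by
    have h1 : ∑ v, cov (some v) * w (some v) ≤ 0 := Finset.sum_nonpos fun v _ => hterm v
    nlinarith
  have he : ∀ v, cov (some v) = b v := by
    intro v
    have h1 : ∑ v, cov (some v) * w (some v) = 0 := by rw [hJ] at hcomp; linarith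
    have h2 := (Finset.sum_eq_zero_iff_of_nonpos fun v _ => hterm v).mp h1 v (Finset.mem_univ v)
    rcases mul_eq_zero.mp h2 with h | h
    · have := hle v
      have := hb0 v
      linarith
    · rw [hwv] at h
      have := (mul_eq_zero.mp h).resolve_left hMc0.ne'
      linarith
  have hxn : ∀ T : JokerClique R r, (∃ i, T.1 i = none) → x T = 0 := by
    rintro T ⟨i, hi⟩
    have h1 := (Finset.sum_eq_zero_iff_of_nonneg fun T _ =>
      mul_nonneg (hx0 T) (tileWeight_nonneg hρ T.1 none)).mp hJ T (Finset.mem_univ T)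
    refine (mul_eq_zero.mp h1).resolve_right ?_
    rw [← hi]
    exact (tileWeight_pos hρ T.1 i).ne'
  let emb : ((⊤ : SimpleGraph (Fin r)) →g R) → JokerClique R r := fun κ =>
    ⟨fun i => some (κ i), fun i j hij => κ.map_adj hij⟩
  have hemb : Function.Injective emb := fun κ κ' h => by
    ext i
    have := congrFun (congrArg Subtype.val h) i
    simpa [emb] using this
  refine ⟨fun κ => x (emb κ), fun κ => hx0 _, fun v => ?_⟩
  rw [← he v]
  refine Fintype.sum_of_injective emb hemb _ _ (fun T hT => ?_) fun κ => ?_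
  · by_cases hn : ∃ i, T.1 i = none
    · rw [hxn T hn, zero_mul]
    · push Not at hn
      refine absurd ?_ hT
      choose g hg using fun i => Option.ne_none_iff_exists'.mp (hn i)
      refine ⟨⟨g, fun {i j} hij => ?_⟩, Subtype.ext (funext fun i => (hg i).symm)⟩
      have := T.2 i j hij
      rwa [hg, hg] at this
  · simp [emb, tileWeight]

lemma exists_cons_hom {W : Type*} {R : SimpleGraph W} {k : ℕ}
    (f : (⊤ : SimpleGraph (Fin k)) →g R) (v : W) (h : ∀ i, R.Adj v (f i)) :
    ∃ f' : (⊤ : SimpleGraph (Fin (k + 1))) →g R, f' 0 = v ∧ ∀ i, f' (Fin.succ i) = f i := by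
  refine ⟨⟨Fin.cons v f, fun {i j} hij => ?_⟩, rfl, fun i => rfl⟩
  induction i using Fin.cases with
  | zero =>
    induction j using Fin.cases with
    | zero => exact absurd rfl hij
    | succ j => exact h j
  | succ i =>
    induction j using Fin.cases with
    | zero => exact (h i).symm
    | succ j => exact f.map_adj fun h => hij (congrArg Fin.succ h)

section

variable {W : Type*} [Fintype W] {R : SimpleGraph W} {r : ℕ} {o s η : ℝ}

lemma DegCond.le_degN (hR : DegCond R r o s η) (hs : 0 < s) (hso : s ≤ o) (v : W) :
    (((r : ℝ) - 2) * o + η) * Fintype.card W ≤ degN R v := by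
  obtain ⟨u, hu, h⟩ := hR {v} (Finset.singleton_nonempty v)
  rw [Finset.mem_singleton] at hu
  subst hu
  have h1 : 0 ≤ min (s * (Fintype.card W : ℝ)) (s / o * (({u} : Finset W).card : ℝ)) := by
    have := hs.trans_le hso
    positivity
  linarith

lemma DegCond.exists_le_degN (hR : DegCond R r o s η) (hs : 0 < s) (hso : s ≤ o) (Z : Finset W)
    (hZ : Z.Nonempty) (hZo : o * Fintype.card W ≤ Z.card) :
    ∃ v ∈ Z, (((r : ℝ) - 2) * o + s + η) * Fintype.card W ≤ degN R v := by
  obtain ⟨v, hv, h⟩ := hR Z hZ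
  refine ⟨v, hv, ?_⟩
  rw [min_eq_left] at h
  · linarith
  · have ho := hs.trans_le hso
    calc s * (Fintype.card W : ℝ) = s / o * (o * Fintype.card W) := by field_simp
      _ ≤ _ := mul_le_mul_of_nonneg_left hZo (div_pos hs ho).le

lemma le_card_filter_adj [DecidableRel R.Adj] (S : Finset W) (v : W) :
    (S.card : ℝ) + degN R v - Fintype.card W ≤ (S.filter (R.Adj v)).card := by
  classical
  rw [degN_eq_card_filter]
  have h1 := Finset.card_union_add_card_inter S (Finset.univ.filter (R.Adj v))
  have h2 : S ∩ Finset.univ.filter (R.Adj v) = S.filter (R.Adj v) := by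
    ext; simp
  have h3 := Finset.card_le_univ (S ∪ Finset.univ.filter (R.Adj v))
  rw [h2] at h1
  have h4 : S.card + (Finset.univ.filter (R.Adj v)).card ≤
      Fintype.card W + (S.filter (R.Adj v)).card := by omega
  have : (S.card : ℝ) + ((Finset.univ.filter (R.Adj v)).card : ℝ) ≤
      (Fintype.card W : ℝ) + ((S.filter (R.Adj v)).card : ℝ) := by exact_mod_cast h4
  linarith

/-- Greedy clique extraction: a clique of size `k + 1` inside `S` with a common neighbour in
`S'`. -/
lemma DegCond.exists_clique (hR : DegCond R r o s η) (hs : 0 < s) (hso : s ≤ o)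
    (hsum : ((r : ℝ) - 1) * o + s = 1) (hη : 0 < η) (k : ℕ) (S S' : Finset W)
    (hS : (k : ℝ) * o * Fintype.card W < S.card)
    (hS' : ((k : ℝ) * o + o + s - η) * Fintype.card W < S'.card) :
    ∃ f : (⊤ : SimpleGraph (Fin (k + 1))) →g R, (∀ i, f i ∈ S) ∧ ∃ w ∈ S', ∀ i, R.Adj w (f i) := by
  classical
  have ho := hs.trans_le hso
  have hm : (0 : ℝ) ≤ Fintype.card W := Nat.cast_nonneg _
  induction k generalizing S S' with
  | zero =>
    have hS0 : S.Nonempty := by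
      rw [← Finset.card_pos]; simpa using hS
    obtain ⟨v, hv⟩ := hS0
    have h1 := le_card_filter_adj (R := R) S' v
    have h2 := hR.le_degN hs hso v
    have h3 : 0 < (S'.filter (R.Adj v)).card := by
      rify
      simp only [Nat.cast_zero, zero_mul, zero_add] at hS'
      nlinarith
    obtain ⟨w, hw⟩ := Finset.card_pos.mp h3
    rw [Finset.mem_filter] at hw
    refine ⟨⟨fun _ => v, fun {i j} hij => absurd (Fin.ext (by omega)) hij⟩, fun _ => hv, w, hw.1,
      fun _ => hw.2.symm⟩
  | succ k ih =>
    push_cast at hS hS'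
    have hk : 0 ≤ (k : ℝ) * o * Fintype.card W := by positivity
    have hoS : o * Fintype.card W ≤ S.card := by nlinarith
    have hS0 : S.Nonempty := by
      rw [← Finset.card_pos]
      have : (0 : ℝ) < S.card := lt_of_le_of_lt (by positivity) hS
      exact_mod_cast this
    obtain ⟨v, hv, hvd⟩ := hR.exists_le_degN hs hso S hS0 hoS
    have h1 := le_card_filter_adj (R := R) S v
    have h2 := le_card_filter_adj (R := R) S' v
    have h3 : (((r : ℝ) - 2) * o + s + η) * Fintype.card W =
        Fintype.card W - o * Fintype.card W + η * Fintype.card W := by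
      linear_combination hsum * (Fintype.card W : ℝ)
    have h4 : 0 ≤ η * (Fintype.card W : ℝ) := by positivity
    obtain ⟨f, hf, w, hw, hfw⟩ := ih (S.filter (R.Adj v)) (S'.filter (R.Adj v))
      (by nlinarith) (by nlinarith)
    obtain ⟨f', hf0, hf'⟩ := exists_cons_hom f v fun i => (Finset.mem_filter.mp (hf i)).2
    rw [Finset.mem_filter] at hw
    refine ⟨f', fun i => ?_, w, hw.1, fun i => ?_⟩
    · induction i using Fin.cases with
      | zero => rw [hf0]; exact hv
      | succ i => rw [hf']; exact (Finset.mem_filter.mp (hf i)).1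
    · induction i using Fin.cases with
      | zero => rw [hf0]; exact hw.2.symm
      | succ i => rw [hf']; exact hfw i

/-- A large set contains all but one vertex of some `r`-clique. -/
lemma DegCond.exists_clique_of_card (hR : DegCond R r o s η) (hr : 2 ≤ r) (hs : 0 < s)
    (hso : s ≤ o) (hsum : ((r : ℝ) - 1) * o + s = 1) (hη : 0 < η) [Nonempty W] (N : Finset W)
    (hN : (((r : ℝ) - 2) * o + η) * Fintype.card W ≤ N.card) (i₀ : Fin r) :
    ∃ f : (⊤ : SimpleGraph (Fin r)) →g R, ∀ i, i ≠ i₀ → f i ∈ N := by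
  obtain ⟨k, rfl⟩ := Nat.exists_eq_add_of_le' hr
  have hm : (0 : ℝ) < Fintype.card W := by exact_mod_cast Fintype.card_pos
  push_cast at hsum hN
  have h1 : 0 < η * (Fintype.card W : ℝ) := by positivity
  obtain ⟨f, hf, w, -, hw⟩ := hR.exists_clique hs hso (by push_cast; exact hsum) hη k N Finset.univ
    (by nlinarith) (by rw [Finset.card_univ]; nlinarith)
  obtain ⟨f', hf0, hf'⟩ := exists_cons_hom f w hw
  refine ⟨f'.comp ⟨Equiv.swap 0 i₀, fun {a b} hab => by simpa using hab⟩, fun i hi => ?_⟩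
  obtain ⟨j, hj⟩ := Fin.exists_succ_eq.mpr (show Equiv.swap 0 i₀ i ≠ 0 by
    rw [Ne, Equiv.swap_apply_eq_iff, Equiv.swap_apply_left]; exact hi)
  change f' (Equiv.swap 0 i₀ i) ∈ N
  rw [← hj, hf']
  exact hf j

/-- An edge at a vertex of large degree extends to an `r`-clique. -/
lemma DegCond.exists_clique_of_adj (hR : DegCond R r o s η) (hr : 3 ≤ r) (hs : 0 < s)
    (hso : s ≤ o) (hsum : ((r : ℝ) - 1) * o + s = 1) (hη : 0 < η) {u v : W} (huv : R.Adj u v)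
    (hu : (((r : ℝ) - 2) * o + s + η) * Fintype.card W ≤ degN R u) :
    ∃ (f : (⊤ : SimpleGraph (Fin r)) →g R) (i j : Fin r), i ≠ j ∧ f i = u ∧ f j = v := by
  classical
  obtain ⟨k, rfl⟩ := Nat.exists_eq_add_of_le' hr
  have hm : (0 : ℝ) < Fintype.card W := by exact_mod_cast Fintype.card_pos_iff.mpr ⟨u⟩
  have h0 := hR.le_degN hs hso v
  push_cast at hsum hu h0
  have h1 : 0 < η * (Fintype.card W : ℝ) := by positivity
  have h2 := le_card_filter_adj (R := R) (Finset.univ.filter (R.Adj u)) v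
  rw [← degN_eq_card_filter] at h2
  have hsum' := congrArg (· * (Fintype.card W : ℝ)) hsum
  obtain ⟨f, hf, -⟩ := hR.exists_clique hs hso (by push_cast; exact hsum) hη k
    ((Finset.univ.filter (R.Adj u)).filter (R.Adj v)) Finset.univ
    (by nlinarith) (by rw [Finset.card_univ]; nlinarith [hs.trans_le hso])
  obtain ⟨f', hf0, hf'⟩ := exists_cons_hom f v fun i => (Finset.mem_filter.mp (hf i)).2
  obtain ⟨g, hg0, hg'⟩ := exists_cons_hom f' u fun i => by
    induction i using Fin.cases with
    | zero => rw [hf0]; exact huv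
    | succ i =>
      rw [hf']
      exact (Finset.mem_filter.mp (Finset.mem_filter.mp (hf i)).1).2
  exact ⟨g, 0, Fin.succ 0, (Fin.succ_ne_zero 0).symm, hg0, (hg' 0).trans hf0⟩

end

lemma exists_perm_apply_eq {ι : Type*} [DecidableEq ι] {i j i' j' : ι} (h : i ≠ j) (h' : i' ≠ j') :
    ∃ π : Equiv.Perm ι, π i' = i ∧ π j' = j := by
  refine ⟨Equiv.swap (Equiv.swap i' i j') j * Equiv.swap i' i, ?_, ?_⟩
  · rw [Equiv.Perm.mul_apply, Equiv.swap_apply_left, Equiv.swap_apply_of_ne_of_ne _ h]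
    intro he
    exact h' ((Equiv.swap_apply_eq_iff.mp he.symm).trans (Equiv.swap_apply_right _ _)).symm
  · rw [Equiv.Perm.mul_apply, Equiv.swap_apply_left]

/-- Precomposition of a clique with a permutation of its positions. -/
def cliquePerm {W : Type*} {R : SimpleGraph W} {r : ℕ}
    (κ : (⊤ : SimpleGraph (Fin r)) →g R) (π : Equiv.Perm (Fin r)) :
    (⊤ : SimpleGraph (Fin r)) →g R :=
  κ.comp ⟨π, fun {a b} hab => by simpa using hab⟩

lemma cliquePerm_apply {W : Type*} {R : SimpleGraph W} {r : ℕ}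
    (κ : (⊤ : SimpleGraph (Fin r)) →g R) (π : Equiv.Perm (Fin r))
    (i : Fin r) : cliquePerm κ π i = κ (π i) := rfl

lemma ncard_eq_sum_ite {α : Type*} [Fintype α] {r : ℕ} (c : α → Fin r) (i : Fin r) :
    ({v | c v = i}.ncard : ℤ) = ∑ v, if c v = i then 1 else 0 := by
  have : {u | c u = i} = ((Finset.univ.filter fun u => c u = i : Finset α) : Set α) := by
    ext; simp
  rw [this, Set.ncard_coe_finset, Finset.card_filter]
  push_cast
  rfl

lemma exists_dvd_iff_smul_mem {M : Type*} [AddCommGroup M] (L : Submodule ℤ M) (x : M) :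
    ∃ d : ℕ, ∀ k : ℤ, k • x ∈ L ↔ (d : ℤ) ∣ k := by
  obtain ⟨d, hd⟩ := (IsPrincipalIdealRing.principal
    (L.comap (LinearMap.toSpanSingleton ℤ M x)) : (L.comap _).IsPrincipal)
  refine ⟨d.natAbs, fun k => ?_⟩
  rw [Int.natAbs_dvd, ← Ideal.mem_span_singleton, ← LinearMap.toSpanSingleton_apply,
    ← Submodule.mem_comap, hd]

section

variable {α W : Type*} [Fintype α] [DecidableEq W] {H : SimpleGraph α} {R : SimpleGraph W}

/-- The vector counting how often each vertex is hit by `φ`. -/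
def countVec (φ : α → W) : W → ℤ := ∑ u, Pi.single (φ u) 1

lemma countVec_apply (φ : α → W) (w : W) : countVec φ w = ({u | φ u = w}.ncard : ℤ) := by
  have : {u | φ u = w} = ((Finset.univ.filter fun u => φ u = w : Finset α) : Set α) := by
    ext; simp
  rw [this, Set.ncard_coe_finset, countVec, Finset.sum_apply, Finset.card_filter]
  push_cast
  refine Finset.sum_congr rfl fun u _ => ?_
  simp [Pi.single_apply, eq_comm]

/-- The lattice generated by the counting vectors of homomorphisms. -/
def homLattice (H : SimpleGraph α) (R : SimpleGraph W) : Submodule ℤ (W → ℤ) :=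
  Submodule.span ℤ (Set.range fun φ : H →g R => countVec φ)

lemma countVec_mem_homLattice (φ : H →g R) : countVec φ ∈ homLattice H R :=
  Submodule.subset_span ⟨φ, rfl⟩

/-- Two homomorphisms may be interchanged on a single component. -/
lemma sum_component_mem_homLattice [DecidableEq H.ConnectedComponent] (φ ψ : H →g R)
    (C : H.ConnectedComponent) :
    ∑ w ∈ Finset.univ.filter (fun w => H.connectedComponentMk w = C),
      ((Pi.single (φ w) 1 : W → ℤ) - Pi.single (ψ w) 1) ∈ homLattice H R := by
  let χ : H →g R := ⟨fun w => if H.connectedComponentMk w = C then ψ w else φ w, fun {a b} hab => by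
    have : H.connectedComponentMk a = H.connectedComponentMk b :=
      SimpleGraph.ConnectedComponent.eq.mpr hab.reachable
    simp only [this]
    split_ifs
    · exact ψ.map_adj hab
    · exact φ.map_adj hab⟩
  convert (homLattice H R).sub_mem (countVec_mem_homLattice φ) (countVec_mem_homLattice χ) using 1
  rw [countVec, countVec, ← Finset.sum_sub_distrib, Finset.sum_filter]
  refine Finset.sum_congr rfl fun w _ => ?_
  by_cases h : H.connectedComponentMk w = C <;> simp [χ, h]

lemma single_sub_single_swap {r : ℕ} (κ : Fin r → W) (i j k : Fin r) :
    (Pi.single (κ k) 1 : W → ℤ) - Pi.single (κ (Equiv.swap i j k)) 1 =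
      ((if k = i then 1 else 0) - (if k = j then 1 else 0) : ℤ) •
        ((Pi.single (κ i) 1 : W → ℤ) - Pi.single (κ j) 1) := by
  by_cases hi : k = i
  · subst hi
    by_cases hj : k = j
    · subst hj; simp
    · simp [hj]
  · by_cases hj : k = j
    · subst hj; simp [hi]
    · simp [hi, hj, Equiv.swap_apply_of_ne_of_ne hi hj]

lemma class_diff_smul_mem {r : ℕ} (κ : (⊤ : SimpleGraph (Fin r)) →g R) (c : H.Coloring (Fin r))
    {i j : Fin r} (hij : i ≠ j) (i' j' : Fin r) :
    (({v | c v = i'}.ncard : ℤ) - ({v | c v = j'}.ncard : ℤ)) •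
      ((Pi.single (κ i) 1 : W → ℤ) - Pi.single (κ j) 1) ∈ homLattice H R := by
  by_cases h' : i' = j'
  · subst h'; simp
  obtain ⟨π, hi, hj⟩ := exists_perm_apply_eq hij h'
  convert (homLattice H R).sub_mem (countVec_mem_homLattice ((cliquePerm κ π).comp c))
    (countVec_mem_homLattice ((cliquePerm (cliquePerm κ π) (Equiv.swap i' j')).comp c)) using 1
  rw [countVec, countVec, ← Finset.sum_sub_distrib, ncard_eq_sum_ite, ncard_eq_sum_ite,
    ← Finset.sum_sub_distrib, Finset.sum_smul]
  refine Finset.sum_congr rfl fun v _ => ?_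
  have := single_sub_single_swap (cliquePerm κ π) i' j' (c v)
  rw [cliquePerm_apply κ π i', cliquePerm_apply κ π j', hi, hj] at this
  exact this.symm

/-- The set of pairs of vertices whose difference lies in the lattice is an equivalence relation. -/
def LatticeRel (H : SimpleGraph α) (R : SimpleGraph W) (u v : W) : Prop :=
  (Pi.single u 1 : W → ℤ) - Pi.single v 1 ∈ homLattice H R

lemma LatticeRel.symm {u v : W} (h : LatticeRel H R u v) : LatticeRel H R v u := by
  have := (homLattice H R).neg_mem h
  rwa [neg_sub] at this

lemma LatticeRel.trans {u v w : W} (h : LatticeRel H R u v) (h' : LatticeRel H R v w) :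
    LatticeRel H R u w := by
  have := (homLattice H R).add_mem h h'
  rwa [sub_add_sub_cancel] at this

lemma latticeRel_of_hcfChiOne {r : ℕ} (hH : HcfChiOne H r)
    (κ : (⊤ : SimpleGraph (Fin r)) →g R) {i j : Fin r} (hij : i ≠ j) :
    LatticeRel H R (κ i) (κ j) := by
  obtain ⟨d, hd⟩ := exists_dvd_iff_smul_mem (homLattice H R)
    ((Pi.single (κ i) 1 : W → ℤ) - Pi.single (κ j) 1)
  have hall : ∀ (c : H.Coloring (Fin r)) (i' j' : Fin r),
      (d : ℤ) ∣ (({v | c v = i'}.ncard : ℤ) - ({v | c v = j'}.ncard : ℤ)) :=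
    fun c i' j' => (hd _).mp (class_diff_smul_mem κ c hij i' j')
  have hd1 : d = 1 := by
    by_contra hne
    rcases Nat.lt_or_ge d 2 with h | h
    · have h0 : d = 0 := by omega
      subst h0
      refine hH 2 le_rfl fun c i' j' => ?_
      have := hall c i' j'
      rw [Nat.cast_zero, zero_dvd_iff] at this
      rw [this]
      exact dvd_zero _
    · exact hH d h hall
  have := (hd 1).mpr (by rw [hd1]; exact dvd_rfl)
  rwa [one_smul] at this

lemma latticeRel_of_adj_of_hcfCompOne (hH : HcfCompOne H) (hH' : HcfChiLeTwo H 2)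
    (κ : (⊤ : SimpleGraph (Fin 2)) →g R) : LatticeRel H R (κ 0) (κ 1) := by
  classical
  obtain ⟨d, hd⟩ := exists_dvd_iff_smul_mem (homLattice H R)
    ((Pi.single (κ 0) 1 : W → ℤ) - Pi.single (κ 1) 1)
  have hall : ∀ (c : H.Coloring (Fin 2)) (i' j' : Fin 2),
      (d : ℤ) ∣ (({v | c v = i'}.ncard : ℤ) - ({v | c v = j'}.ncard : ℤ)) :=
    fun c i' j' => (hd _).mp (class_diff_smul_mem κ c (by decide) i' j')
  obtain ⟨⟨c, i', j', hne⟩, h3⟩ := hH'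
  have hd0 : d ≠ 0 := by
    rintro rfl
    have := hall c i' j'
    rw [Nat.cast_zero, zero_dvd_iff, sub_eq_zero] at this
    exact hne (by exact_mod_cast this)
  have hd3 : d < 3 := by
    by_contra h
    exact h3 d (by omega) hall
  have hd2 : d ≠ 2 := by
    rintro rfl
    obtain ⟨C, hC⟩ := hH 2 le_rfl
    apply hC
    have h1 := sum_component_mem_homLattice (κ.comp c)
      ((cliquePerm κ (Equiv.swap 0 1)).comp c) C
    have h2 : ∀ w, (Pi.single ((κ.comp c) w) 1 : W → ℤ) -
        Pi.single (((cliquePerm κ (Equiv.swap 0 1)).comp c) w) 1 = _ :=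
      fun w => single_sub_single_swap κ 0 1 (c w)
    rw [Finset.sum_congr rfl fun w _ => h2 w, ← Finset.sum_smul, hd] at h1
    have h3 : C.supp = ((Finset.univ.filter fun w => H.connectedComponentMk w = C : Finset α) :
        Set α) := by
      ext; simp
    rw [h3, Set.ncard_coe_finset, Finset.card_eq_sum_ones]
    have h4 : ∀ w, ((1 : ℕ) : ℤ) = ((if c w = 0 then 1 else 0) - (if c w = 1 then 1 else 0) : ℤ) +
        ((2 : ℕ) : ℤ) * (if c w = 1 then 1 else 0) := by
      intro w
      have : c w = 0 ∨ c w = 1 := by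
        have := (c w).2
        rcases Nat.lt_or_ge (c w : ℕ) 1 with h | h
        · exact Or.inl (Fin.ext (by simp; omega))
        · exact Or.inr (Fin.ext (by simp; omega))
      rcases this with h | h <;> simp [h]
    rw [← Int.natCast_dvd_natCast, Nat.cast_sum, Finset.sum_congr rfl fun w _ => h4 w,
      Finset.sum_add_distrib, ← Finset.mul_sum]
    exact dvd_add h1 (dvd_mul_right _ _)
  have := (hd 1).mpr (by rw [show d = 1 by omega]; exact dvd_rfl)
  rwa [one_smul] at this

lemma latticeRel_of_hcfCompOne (hH : HcfCompOne H) (hH' : HcfChiLeTwo H 2) (c : H.Coloring (Fin 2))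
    (κ κ' : (⊤ : SimpleGraph (Fin 2)) →g R) : LatticeRel H R (κ 0) (κ' 0) := by
  classical
  obtain ⟨d, hd⟩ := exists_dvd_iff_smul_mem (homLattice H R)
    ((Pi.single (κ 0) 1 : W → ℤ) - Pi.single (κ' 0) 1)
  have hrel : ∀ (κ : (⊤ : SimpleGraph (Fin 2)) →g R) (i : Fin 2), LatticeRel H R (κ 0) (κ i) := by
    intro κ i
    have : i = 0 ∨ i = 1 := by fin_cases i <;> simp
    rcases this with rfl | rfl
    · simp [LatticeRel]
    · exact latticeRel_of_adj_of_hcfCompOne hH hH' κ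
  have hall : ∀ C : H.ConnectedComponent, d ∣ C.supp.ncard := by
    intro C
    have h3 : C.supp = ((Finset.univ.filter fun w => H.connectedComponentMk w = C : Finset α) :
        Set α) := by
      ext; simp
    rw [h3, Set.ncard_coe_finset, ← Int.natCast_dvd_natCast, ← hd, natCast_zsmul,
      ← Finset.sum_const]
    have h4 : ∀ w, (Pi.single (κ 0) 1 : W → ℤ) - Pi.single (κ' 0) 1 =
        ((Pi.single (κ 0) 1 - Pi.single (κ (c w)) 1) -
          (Pi.single (κ' 0) 1 - Pi.single (κ' (c w)) 1)) +
        (Pi.single ((κ.comp c) w) 1 - Pi.single ((κ'.comp c) w) 1) := by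
      intro w
      change _ = _ + (Pi.single (κ (c w)) 1 - Pi.single (κ' (c w)) 1)
      abel
    rw [Finset.sum_congr rfl fun w _ => h4 w, Finset.sum_add_distrib]
    exact Submodule.add_mem _ (Submodule.sum_mem _ fun w _ =>
      Submodule.sub_mem _ (hrel κ (c w)) (hrel κ' (c w)))
      (sum_component_mem_homLattice (κ.comp c) (κ'.comp c) C)
  have hd1 : d = 1 := by
    by_contra hne
    rcases Nat.lt_or_ge d 2 with h | h
    · have h0 : d = 0 := by omega
      obtain ⟨C, hC⟩ := hH 2 le_rfl
      have := hall C
      rw [h0, zero_dvd_iff] at this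
      rw [this] at hC
      exact hC (dvd_zero _)
    · obtain ⟨C, hC⟩ := hH d h
      exact hC (hall C)
  have := (hd 1).mpr (by rw [hd1]; exact dvd_rfl)
  rwa [one_smul] at this

lemma mem_homLattice_of_latticeRel [Fintype W] (hall : ∀ u v, LatticeRel H R u v) (φ : H →g R)
    (v₀ : W) (z : W → ℤ) (hz : (Fintype.card α : ℤ) ∣ ∑ w, z w) : z ∈ homLattice H R := by
  have h1 : (Fintype.card α : ℤ) • (Pi.single v₀ 1 : W → ℤ) ∈ homLattice H R := by
    have h2 : (Fintype.card α : ℤ) • (Pi.single v₀ 1 : W → ℤ) =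
        countVec φ - ∑ u, ((Pi.single (φ u) 1 : W → ℤ) - Pi.single v₀ 1) := by
      rw [countVec, Finset.sum_sub_distrib, Finset.sum_const, Finset.card_univ, natCast_zsmul]
      abel
    rw [h2]
    exact Submodule.sub_mem _ (countVec_mem_homLattice φ) (Submodule.sum_mem _ fun u _ => hall _ _)
  obtain ⟨k, hk⟩ := hz
  have h3 : z = ∑ w, z w • ((Pi.single w 1 : W → ℤ) - Pi.single v₀ 1) +
      k • ((Fintype.card α : ℤ) • (Pi.single v₀ 1 : W → ℤ)) := by
    rw [smul_smul, mul_comm, ← hk]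
    simp only [smul_sub]
    rw [Finset.sum_sub_distrib, ← Finset.sum_smul, sub_add_cancel]
    ext w
    simp [Finset.sum_apply, Pi.single_apply]
  rw [h3]
  exact Submodule.add_mem _ (Submodule.sum_mem _ fun w _ => Submodule.smul_mem _ _ (hall _ _))
    (Submodule.smul_mem _ _ h1)

/-- Under the degree condition the lattice contains every vector whose sum is divisible by the
order of `H`. -/
lemma DegCond.mem_homLattice [Fintype W] [Nonempty W] {r : ℕ} {o s η : ℝ}
    (hR : DegCond R r o s η) (hr : 2 ≤ r) (hs : 0 < s)
    (hso : s ≤ o) (hsum : ((r : ℝ) - 1) * o + s = 1) (hη : 0 < η) (hH : HcfOne H r)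
    (c : H.Coloring (Fin r)) (z : W → ℤ) (hz : (Fintype.card α : ℤ) ∣ ∑ w, z w) :
    z ∈ homLattice H R := by
  classical
  have hm : (0 : ℝ) < Fintype.card W := by exact_mod_cast Fintype.card_pos
  have ho := hs.trans_le hso
  obtain ⟨v₀⟩ := ‹Nonempty W›
  have hN : ∀ v, (((r : ℝ) - 2) * o + η) * Fintype.card W ≤
      (Finset.univ.filter (R.Adj v)).card := fun v => by
    rw [← degN_eq_card_filter]
    exact hR.le_degN hs hso v
  obtain ⟨κ, -⟩ := hR.exists_clique_of_card hr hs hso hsum hη _ (hN v₀) ⟨0, by omega⟩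
  refine mem_homLattice_of_latticeRel ?_ (κ.comp c) v₀ z hz
  have hr' : (2 : ℝ) ≤ r := by exact_mod_cast hr
  have hr0 : 0 ≤ ((r : ℝ) - 2) * o := mul_nonneg (by linarith) ho.le
  have hne : ∀ v, (Finset.univ.filter (R.Adj v)).Nonempty := by
    intro v
    rw [← Finset.card_pos]
    have : (0 : ℝ) < (Finset.univ.filter (R.Adj v)).card :=
      lt_of_lt_of_le (by positivity) (hN v)
    exact_mod_cast this
  by_cases h2 : r = 2
  · subst h2
    have hedge : ∀ v, ∃ κ : (⊤ : SimpleGraph (Fin 2)) →g R, κ 0 = v := by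
      intro v
      obtain ⟨w, hw⟩ := hne v
      rw [Finset.mem_filter] at hw
      let g : (⊤ : SimpleGraph (Fin 1)) →g R :=
        ⟨fun _ => w, fun {i j} hij => absurd (Subsingleton.elim i j) hij⟩
      obtain ⟨f, hf, -⟩ := exists_cons_hom g v fun _ => hw.2
      exact ⟨f, hf⟩
    intro u v
    obtain ⟨κu, rfl⟩ := hedge u
    obtain ⟨κv, rfl⟩ := hedge v
    exact latticeRel_of_hcfCompOne (hH.1 rfl).1 (hH.1 rfl).2 c κu κv
  · have hr3 : 3 ≤ r := by omega
    have hr3' : (3 : ℝ) ≤ r := by exact_mod_cast hr3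
    have hrel : ∀ u v, R.Adj u v →
        (((r : ℝ) - 2) * o + s + η) * Fintype.card W ≤ degN R u → LatticeRel H R u v := by
      intro u v huv hu
      obtain ⟨f, i, j, hij, rfl, rfl⟩ := hR.exists_clique_of_adj hr3 hs hso hsum hη huv hu
      exact latticeRel_of_hcfChiOne (hH.2 h2) f hij
    have hgood : ∀ u, ∃ g, (((r : ℝ) - 2) * o + s + η) * Fintype.card W ≤ degN R g ∧
        LatticeRel H R g u := by
      intro u
      obtain ⟨g, hg, hgd⟩ := hR.exists_le_degN hs hso _ (hne u) ((mul_le_mul_of_nonneg_right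
        (by nlinarith) hm.le).trans (hN u))
      exact ⟨g, hgd, hrel g u (Finset.mem_filter.mp hg).2.symm hgd⟩
    intro u v
    obtain ⟨g, hg, hgu⟩ := hgood u
    obtain ⟨g', hg', hgv⟩ := hgood v
    have h1 := le_card_filter_adj (R := R) (Finset.univ.filter (R.Adj g)) g'
    rw [← degN_eq_card_filter] at h1
    have h3 : (0 : ℝ) < ((Finset.univ.filter (R.Adj g)).filter (R.Adj g')).card := by
      have h4 : 1 < 2 * (((r : ℝ) - 2) * o + s + η) := by nlinarith
      nlinarith
    obtain ⟨x, hx⟩ := Finset.card_pos.mp (by exact_mod_cast h3)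
    simp only [Finset.mem_filter, Finset.mem_univ, true_and] at hx
    exact hgu.symm.trans ((hrel g x hx.1 hg).trans ((hrel g' x hx.2 hg').symm.trans hgv))

end

section

variable {α : Type*} [Fintype α]

/-- Averaging a colouring over the permutations of the colours fixing `i₀` equalises all the
other colour classes. -/
lemma sum_perm_card_class {r : ℕ} (hr : 2 ≤ r) (i₀ : Fin r) (c : α → Fin r) {o s : ℝ}
    (hs : s * Fintype.card α = ((Finset.univ.filter fun u => c u = i₀).card : ℝ))
    (hsum : ((r : ℝ) - 1) * o + s = 1) (i : Fin r) :
    ∑ π ∈ Finset.univ.filter (fun π : Equiv.Perm (Fin r) => π i₀ = i₀),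
        ((Finset.univ.filter fun u => π (c u) = i).card : ℝ) =
      (Finset.univ.filter fun π : Equiv.Perm (Fin r) => π i₀ = i₀).card *
        (Fintype.card α * cliqueWeight i₀ o s i) := by
  set F := Finset.univ.filter fun π : Equiv.Perm (Fin r) => π i₀ = i₀ with hF
  set n : Fin r → ℝ := fun i => ∑ π ∈ F, ((Finset.univ.filter fun u => π (c u) = i).card : ℝ)
    with hn
  have h0 : n i₀ = F.card * (Fintype.card α * s) := by
    rw [hn, mul_comm (Fintype.card α : ℝ), hs, ← nsmul_eq_mul, ← Finset.sum_const]
    refine Finset.sum_congr rfl fun π hπ => ?_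
    have hπ' : π i₀ = i₀ := by simpa [hF] using hπ
    congr 2
    ext u
    simp only [Finset.mem_filter, Finset.mem_univ, true_and]
    conv_lhs => rw [← hπ']
    exact π.injective.eq_iff
  have htot : ∑ i, n i = F.card * Fintype.card α := by
    simp only [hn]
    rw [Finset.sum_comm, ← nsmul_eq_mul, ← Finset.sum_const]
    refine Finset.sum_congr rfl fun π _ => ?_
    have := Finset.card_eq_sum_card_fiberwise (f := fun u => π (c u)) (s := Finset.univ)
      (t := Finset.univ) (fun u _ => by simp)
    rw [Finset.card_univ] at this
    rw [this]
    push_cast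
    rfl
  have heq : ∀ i j, i ≠ i₀ → j ≠ i₀ → n i = n j := by
    intro i j hi hj
    simp only [hn]
    refine Finset.sum_bij' (fun π _ => Equiv.swap i j * π) (fun π _ => Equiv.swap i j * π)
      ?_ ?_ ?_ ?_ ?_
    · intro π hπ
      simp only [hF, Finset.mem_filter, Finset.mem_univ, true_and] at hπ ⊢
      rw [Equiv.Perm.mul_apply, hπ, Equiv.swap_apply_of_ne_of_ne hi.symm hj.symm]
    · intro π hπ
      simp only [hF, Finset.mem_filter, Finset.mem_univ, true_and] at hπ ⊢
      rw [Equiv.Perm.mul_apply, hπ, Equiv.swap_apply_of_ne_of_ne hi.symm hj.symm]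
    · intro π _; simp [← mul_assoc]
    · intro π _; simp [← mul_assoc]
    · intro π _
      have : ∀ u, π (c u) = i ↔ (Equiv.swap i j * π) (c u) = j := fun u => by
        rw [Equiv.Perm.mul_apply, Equiv.swap_apply_eq_iff, Equiv.swap_apply_right]
      rw [Finset.filter_congr fun u _ => this u]
  change n i = _
  by_cases hi : i = i₀
  · subst hi
    simp [h0, cliqueWeight]
  · rw [cliqueWeight, if_neg hi]
    rw [← Finset.add_sum_erase _ _ (Finset.mem_univ i₀), h0,
      Finset.sum_congr rfl fun j hj => heq j i (Finset.ne_of_mem_erase hj) hi] at htot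
    have hr1 : 1 ≤ r := by omega
    simp only [Finset.sum_const, Finset.card_erase_of_mem (Finset.mem_univ i₀), Finset.card_univ,
      Fintype.card_fin, nsmul_eq_mul, Nat.cast_sub hr1, Nat.cast_one] at htot
    have hr' : (0 : ℝ) < (r : ℝ) - 1 := by
      have : (2 : ℝ) ≤ r := by exact_mod_cast hr
      linarith
    refine mul_left_cancel₀ hr'.ne' ?_
    linear_combination htot - (F.card * Fintype.card α : ℝ) * hsum

variable {W : Type*} [DecidableEq W] {H : SimpleGraph α} {R : SimpleGraph W}

lemma countVec_comp {r : ℕ} (c : α → Fin r) (κ : Fin r → W) (w : W) :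
    (countVec (fun u => κ (c u)) w : ℝ) =
      ∑ i, if κ i = w then ((Finset.univ.filter fun u => c u = i).card : ℝ) else 0 := by
  rw [countVec, Finset.sum_apply]
  push_cast
  rw [← Finset.sum_fiberwise Finset.univ c]
  refine Finset.sum_congr rfl fun i _ => ?_
  rw [Finset.sum_congr rfl fun u hu => by rw [(Finset.mem_filter.mp hu).2]]
  by_cases h : κ i = w
  · subst h; simp
  · simp [h, Ne.symm h]

lemma countVec_nonneg (φ : α → W) (w : W) : 0 ≤ countVec φ w := by
  rw [countVec_apply]; positivity

lemma countVec_le (φ : α → W) (w : W) : countVec φ w ≤ Fintype.card α := by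
  rw [countVec_apply]
  exact_mod_cast (Set.ncard_le_card _).trans (by simp)

lemma sum_countVec [Fintype W] (φ : α → W) : ∑ w, countVec φ w = Fintype.card α := by
  simp only [countVec, Finset.sum_apply]
  rw [Finset.sum_comm]
  simp

/-- Under the degree condition some strictly positive combination of all homomorphisms covers
every vertex with total weight one. -/
lemma DegCond.exists_pos_combination [Fintype W] [Nonempty α] {r : ℕ} {o s η : ℝ}
    (hR : DegCond R r o s η)
    (hr : 2 ≤ r) (hs : 0 < s) (hso : s ≤ o) (hsum : ((r : ℝ) - 1) * o + s = 1) (hη : 0 < η)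
    (c : H.Coloring (Fin r)) (i₀ : Fin r)
    (hc : s * Fintype.card α = ((Finset.univ.filter fun u => c u = i₀).card : ℝ))
    [Fintype (H →g R)] :
    ∃ y : (H →g R) → ℝ, (∀ φ, 0 < y φ) ∧ ∀ w, ∑ φ, y φ * (countVec φ w : ℝ) = 1 := by
  classical
  let : Fintype ((⊤ : SimpleGraph (Fin r)) →g R) := Fintype.ofFinite _
  have hh : (0 : ℝ) < Fintype.card α := by exact_mod_cast Fintype.card_pos
  set h : ℝ := (Fintype.card α : ℝ) with hhdef
  set Φ : ℝ := (Fintype.card (H →g R) : ℝ) with hΦ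
  set δ := min η 1 / 2 with hδ
  have hδ0 : 0 < δ := by positivity
  have hδη : δ < η := by
    have := min_le_left η 1
    linarith
  have hδ1 : δ ≤ 1 := by
    have := min_le_right η 1
    linarith
  set δ' := δ / (Φ * h + 1) with hδ'
  have hΦ0 : 0 ≤ Φ := Nat.cast_nonneg _
  have hδ'0 : 0 < δ' := by positivity
  set A : W → ℝ := fun w => ∑ φ : H →g R, (countVec φ w : ℝ) with hA
  have hA0 : ∀ w, 0 ≤ A w := fun w => Finset.sum_nonneg fun φ _ => by
    exact_mod_cast countVec_nonneg φ w
  have hA1 : ∀ w, A w ≤ Φ * h := fun w => by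
    calc A w ≤ ∑ _φ : H →g R, h := Finset.sum_le_sum fun φ _ => by
          rw [hhdef]
          exact_mod_cast countVec_le φ w
      _ = Φ * h := by simp [hΦ]
  have hδA : ∀ w, δ' * A w ≤ δ := fun w => by
    rw [hδ', div_mul_eq_mul_div, div_le_iff₀ (by positivity)]
    exact mul_le_mul_of_nonneg_left ((hA1 w).trans (by linarith)) hδ0.le
  obtain ⟨x, hx0, hx⟩ := exists_fractional_tiling R hr i₀ hs hso hsum hδ0.le hδη hδ1 hR
    (fun w => 1 - δ' * A w) (fun w => by linarith [hδA w])
    (fun w => by linarith [mul_nonneg hδ'0.le (hA0 w)])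
  set F := Finset.univ.filter fun π : Equiv.Perm (Fin r) => π i₀ = i₀ with hF
  have hF0 : (0 : ℝ) < F.card := by
    have : F.Nonempty := ⟨1, by simp [hF]⟩
    exact_mod_cast this.card_pos
  let hom : ((⊤ : SimpleGraph (Fin r)) →g R) → Equiv.Perm (Fin r) → (H →g R) :=
    fun κ π => (cliquePerm κ π).comp c
  refine ⟨fun φ => δ' + ∑ κ, ∑ π ∈ F, if hom κ π = φ then x κ / (F.card * h) else 0,
    fun φ => add_pos_of_pos_of_nonneg hδ'0 (Finset.sum_nonneg fun κ _ => Finset.sum_nonneg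
      fun π _ => ?_), fun w => ?_⟩
  · split_ifs
    · exact div_nonneg (hx0 κ) (by positivity)
    · exact le_rfl
  · simp only [add_mul, Finset.sum_add_distrib, ← Finset.mul_sum, Finset.sum_mul]
    rw [Finset.sum_comm]
    have h1 : ∀ κ, ∑ φ : H →g R, ∑ π ∈ F,
        (if hom κ π = φ then x κ / (F.card * h) else 0) * (countVec φ w : ℝ) =
        x κ * ∑ i, (if κ i = w then cliqueWeight i₀ o s i else 0) := by
      intro κ
      rw [Finset.sum_comm]
      have h2 : ∀ π ∈ F, ∑ φ : H →g R,
          (if hom κ π = φ then x κ / (F.card * h) else 0) * (countVec φ w : ℝ) =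
          x κ / (F.card * h) * ∑ i, if κ i = w then
            ((Finset.univ.filter fun u => π (c u) = i).card : ℝ) else 0 := by
        intro π _
        rw [Finset.sum_eq_single (hom κ π)]
        · rw [if_pos rfl, ← countVec_comp (fun u => π (c u)) κ w]
          rfl
        · intro φ _ hφ; simp [hφ.symm]
        · simp
      rw [Finset.sum_congr rfl h2, ← Finset.mul_sum, Finset.sum_comm, Finset.mul_sum,
        Finset.mul_sum]
      refine Finset.sum_congr rfl fun i _ => ?_
      split_ifs
      · rw [sum_perm_card_class hr i₀ c hc hsum i, ← hF, ← hhdef]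
        field_simp
      · simp
    rw [Finset.sum_congr rfl fun κ _ => h1 κ, hx w]
    simp only [hA]
    ring

end

/-- Large almost constant vectors in the lattice are nonnegative integer combinations. -/
lemma exists_nat_combination {Φ W : Type*} [Fintype Φ] [Fintype W] (a : Φ → W → ℤ)
    (y : Φ → ℝ) (hy : ∀ φ, 0 < y φ) (hya : ∀ w, ∑ φ, y φ * (a φ w : ℝ) = 1) (h : ℤ)
    (ha : ∀ φ, h ∣ ∑ w, a φ w)
    (hL : ∀ z : W → ℤ, h ∣ ∑ w, z w → z ∈ Submodule.span ℤ (Set.range a)) (C : ℕ) :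
    ∃ t₀ : ℕ, ∀ t : ℕ, t₀ ≤ t → ∀ c : W → ℤ, (∀ w, |c w| ≤ C) → h ∣ ∑ w, ((t : ℤ) - c w) →
      ∃ n : Φ → ℕ, ∀ w, ∑ φ, (n φ : ℤ) * a φ w = t - c w := by
  classical
  have hk : ∀ ρ : W → ℤ, ∃ k : Φ → ℤ, h ∣ ∑ w, ρ w → ∀ w, ∑ φ, k φ * a φ w = ρ w := by
    intro ρ
    by_cases hρ : h ∣ ∑ w, ρ w
    · obtain ⟨k, hk⟩ := (Submodule.mem_span_range_iff_exists_fun ℤ).mp (hL ρ hρ)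
      exact ⟨k, fun _ w => by rw [← hk]; simp [Finset.sum_apply]⟩
    · exact ⟨0, fun h => absurd h hρ⟩
  choose k hk using hk
  set D : ℤ := C + ∑ φ, ∑ w, |a φ w| with hD
  set K : ℤ := ∑ ρ ∈ Finset.Icc (fun _ : W => -D) (fun _ => D), ∑ φ, |k ρ φ| with hK
  have hK0 : 0 ≤ K := Finset.sum_nonneg fun ρ _ => Finset.sum_nonneg fun φ _ => abs_nonneg _
  have hKk : ∀ ρ : W → ℤ, (∀ w, |ρ w| ≤ D) → ∀ φ, |k ρ φ| ≤ K := by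
    intro ρ hρ φ
    refine (Finset.single_le_sum (f := fun φ => |k ρ φ|) (fun _ _ => abs_nonneg _)
      (Finset.mem_univ φ)).trans (Finset.single_le_sum (f := fun ρ => ∑ φ, |k ρ φ|)
        (fun _ _ => Finset.sum_nonneg fun _ _ => abs_nonneg _) ?_)
    rw [Finset.mem_Icc]
    exact ⟨fun w => (abs_le.mp (hρ w)).1, fun w => (abs_le.mp (hρ w)).2⟩
  refine ⟨∑ φ, ⌈(K : ℝ) / y φ⌉₊, fun t ht c hc hdiv => ?_⟩
  set ρ : W → ℤ := fun w => t - c w - ∑ φ, ⌊t * y φ⌋ * a φ w with hρ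
  have hρle : ∀ w, |ρ w| ≤ D := by
    intro w
    have h1 : (ρ w : ℝ) = ∑ φ, Int.fract (t * y φ) * (a φ w : ℝ) - c w := by
      have h2 : ∀ φ, Int.fract (t * y φ) * (a φ w : ℝ) =
          t * (y φ * a φ w) - (⌊t * y φ⌋ : ℝ) * a φ w := fun φ => by
        rw [Int.fract]; ring
      rw [Finset.sum_congr rfl fun φ _ => h2 φ, Finset.sum_sub_distrib, ← Finset.mul_sum, hya]
      simp only [hρ]
      push_cast
      ring
    have h3 : |∑ φ, Int.fract (t * y φ) * (a φ w : ℝ)| ≤ ∑ φ, |(a φ w : ℝ)| := by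
      refine (Finset.abs_sum_le_sum_abs _ _).trans (Finset.sum_le_sum fun φ _ => ?_)
      rw [abs_mul, abs_of_nonneg (Int.fract_nonneg _)]
      exact mul_le_of_le_one_left (abs_nonneg _) (Int.fract_lt_one _).le
    have h4 : ∑ φ, |a φ w| ≤ ∑ φ, ∑ w, |a φ w| := Finset.sum_le_sum fun φ _ =>
      Finset.single_le_sum (f := fun w => |a φ w|) (fun _ _ => abs_nonneg _) (Finset.mem_univ w)
    have h5 : |(ρ w : ℝ)| ≤ ∑ φ, |(a φ w : ℝ)| + C := by
      rw [h1]
      refine (abs_sub _ _).trans (add_le_add h3 ?_)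
      exact_mod_cast hc w
    have h6 : |ρ w| ≤ ∑ φ, |a φ w| + C := by exact_mod_cast h5
    linarith
  have hρdiv : h ∣ ∑ w, ρ w := by
    simp only [hρ]
    rw [Finset.sum_sub_distrib, Finset.sum_comm]
    refine dvd_sub hdiv (Finset.dvd_sum fun φ _ => ?_)
    rw [← Finset.mul_sum]
    exact dvd_mul_of_dvd_right (ha φ) _
  have hn : ∀ φ, 0 ≤ ⌊t * y φ⌋ + k ρ φ := by
    intro φ
    have h1 := (abs_le.mp (hKk ρ hρle φ)).1
    have h2 : ⌈(K : ℝ) / y φ⌉₊ ≤ t := (Finset.single_le_sum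
      (f := fun φ => ⌈(K : ℝ) / y φ⌉₊) (fun _ _ => Nat.zero_le _) (Finset.mem_univ φ)).trans ht
    have h3 : (K : ℝ) ≤ t * y φ := by
      rw [← div_le_iff₀ (hy φ)]
      exact Nat.ceil_le.mp h2
    have h4 : K ≤ ⌊t * y φ⌋ := Int.le_floor.mpr h3
    linarith
  refine ⟨fun φ => (⌊t * y φ⌋ + k ρ φ).toNat, fun w => ?_⟩
  have h1 := hk ρ hρdiv w
  simp only [Int.toNat_of_nonneg (hn _), add_mul, Finset.sum_add_distrib, h1]
  simp only [hρ]
  ring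

/-- A large blow-up of a graph satisfying the degree condition, together with a bounded number of
additional vertices of large degree, can be tiled: homomorphisms from `H` cover each vertex of the
graph exactly `t` times and each additional vertex exactly once. -/
lemma exists_balanced_homs {α W X : Type*} [Fintype α] [Fintype W] [Fintype X] [Nonempty α]
    [Nonempty W] {H : SimpleGraph α} {r : ℕ} {o s η : ℝ} (Γ : SimpleGraph (W ⊕ X))
    (hR : DegCond (Γ.comap Sum.inl) r o s η) (hr : 2 ≤ r) (hs : 0 < s) (hso : s ≤ o)
    (hsum : ((r : ℝ) - 1) * o + s = 1) (hη : 0 < η) (hH : HcfOne H r)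
    (c : H.Coloring (Fin r)) (i₀ : Fin r)
    (hc : s * Fintype.card α = ((Finset.univ.filter fun u => c u = i₀).card : ℝ))
    (hX : ∀ x, (((r : ℝ) - 2) * o + η) * Fintype.card W ≤
      ({w | Γ.Adj (Sum.inr x) (Sum.inl w)}.ncard : ℝ))
    (hWα : Fintype.card α ∣ Fintype.card W) (hXα : Fintype.card α ∣ Fintype.card X) :
    ∃ t₀ : ℕ, ∀ t : ℕ, t₀ ≤ t → ∃ (k : ℕ) (g : Fin k → (H →g Γ)),
      (∀ w, Nat.card {p : Fin k × α // g p.1 p.2 = Sum.inl w} = t) ∧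
      ∀ x, Nat.card {p : Fin k × α // g p.1 p.2 = Sum.inr x} = 1 := by
  classical
  obtain ⟨u₀⟩ := ‹Nonempty α›
  have hψ : ∀ x, ∃ ψ : H →g Γ, ∃ κ : α → W, ∀ u, ψ u = if u = u₀ then Sum.inr x else
      Sum.inl (κ u) := by
    intro x
    have hN := hX x
    have : {w | Γ.Adj (Sum.inr x) (Sum.inl w)} =
        ((Finset.univ.filter fun w => Γ.Adj (Sum.inr x) (Sum.inl w) : Finset W) : Set W) := by
      ext; simp
    rw [this, Set.ncard_coe_finset] at hN
    obtain ⟨f, hf⟩ := hR.exists_clique_of_card hr hs hso hsum hη _ hN (c u₀)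
    have hadj : ∀ u, H.Adj u₀ u → Γ.Adj (Sum.inr x) (Sum.inl (f (c u))) := fun u hu => by
      have := hf (c u) (c.map_adj hu.symm)
      simpa using this
    refine ⟨⟨fun u => if u = u₀ then Sum.inr x else Sum.inl (f (c u)), fun {a b} hab => ?_⟩,
      fun u => f (c u), fun u => rfl⟩
    by_cases ha : a = u₀
    · subst ha
      simp only [if_true, if_neg hab.ne', hadj b hab]
    · by_cases hb : b = u₀
      · subst hb
        simp only [if_true, if_neg ha, (hadj a hab.symm).symm]
      · simp only [if_neg ha, if_neg hb]
        exact f.map_adj (c.map_adj hab)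
  choose ψ κ hψ using hψ
  let R := Γ.comap (Sum.inl : W → W ⊕ X)
  let : Fintype (H →g R) := Fintype.ofFinite _
  obtain ⟨y, hy0, hy⟩ := hR.exists_pos_combination (H := H) hr hs hso hsum hη c i₀ hc
  obtain ⟨t₀, ht₀⟩ := exists_nat_combination (fun (φ : H →g R) => countVec φ) y hy0 hy
    (Fintype.card α) (fun φ => by rw [sum_countVec])
    (fun z hz => hR.mem_homLattice hr hs hso hsum hη hH c z hz) (Fintype.card (X × α))
  refine ⟨t₀, fun t ht => ?_⟩
  let cc : W → ℕ := fun w => (Finset.univ.filter fun p : X × α => ψ p.1 p.2 = Sum.inl w).card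
  have hccsum : ∑ w, (cc w : ℤ) = Fintype.card X * (Fintype.card α - 1) := by
    have h1 : ∀ w, (cc w : ℤ) = ∑ x, ∑ u ∈ Finset.univ.erase u₀, if κ x u = w then 1 else 0 := by
      intro w
      simp only [cc]
      rw [Finset.card_filter, Fintype.sum_prod_type]
      push_cast
      refine Finset.sum_congr rfl fun x _ => ?_
      rw [← Finset.add_sum_erase _ _ (Finset.mem_univ u₀), hψ, if_pos rfl, if_neg (by simp),
        zero_add]
      refine Finset.sum_congr rfl fun u hu => ?_
      rw [hψ, if_neg (Finset.ne_of_mem_erase hu)]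
      simp
    rw [Finset.sum_congr rfl fun w _ => h1 w, Finset.sum_comm]
    have h2 : ∀ x, ∑ w : W, ∑ u ∈ Finset.univ.erase u₀, (if κ x u = w then (1 : ℤ) else 0) =
        Fintype.card α - 1 := by
      intro x
      rw [Finset.sum_comm]
      have : 1 ≤ Fintype.card α := Fintype.card_pos_iff.mpr ⟨u₀⟩
      simp [Finset.card_erase_of_mem, this]
    rw [Finset.sum_congr rfl fun x _ => h2 x]
    simp
    ring
  obtain ⟨n, hn⟩ := ht₀ t ht (fun w => cc w)
    (fun w => by
      rw [abs_of_nonneg (Int.natCast_nonneg _)]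
      exact_mod_cast Finset.card_le_univ _)
    (by
      rw [Finset.sum_sub_distrib, hccsum, Finset.sum_const, Finset.card_univ, nsmul_eq_mul]
      exact dvd_sub (dvd_mul_of_dvd_left (Int.natCast_dvd_natCast.mpr hWα) _)
        (dvd_mul_of_dvd_left (Int.natCast_dvd_natCast.mpr hXα) _))
  let inlHom : R →g Γ := ⟨Sum.inl, fun h => h⟩
  let g' : X ⊕ (Σ φ : H →g R, Fin (n φ)) → (H →g Γ) :=
    Sum.elim ψ fun p => inlHom.comp p.1
  let e := Fintype.equivFin (X ⊕ (Σ φ : H →g R, Fin (n φ)))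
  refine ⟨_, fun q => g' (e.symm q), fun w => ?_, fun x => ?_⟩
  all_goals
    rw [Nat.card_congr ((e.symm.prodCongr (Equiv.refl α)).subtypeEquiv
      (q := fun p => g' p.1 p.2 = _)
      fun p => by rfl), Nat.card_eq_fintype_card, Fintype.card_subtype, Finset.card_filter,
      Fintype.sum_prod_type, Fintype.sum_sum_type]
  · have h1 : ∑ x : X, ∑ u, (if g' (Sum.inl x) u = Sum.inl w then 1 else 0) = cc w := by
      simp only [cc]
      rw [Finset.card_filter, Fintype.sum_prod_type]
      rfl
    have h2 : ∑ p : (Σ φ : H →g R, Fin (n φ)), ∑ u,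
        (if g' (Sum.inr p) u = Sum.inl w then (1 : ℤ) else 0) = t - cc w := by
      rw [← hn w, Fintype.sum_sigma]
      refine Finset.sum_congr rfl fun φ _ => ?_
      have h3 : ∀ i : Fin (n φ), ∑ u, (if g' (Sum.inr ⟨φ, i⟩) u = Sum.inl w then (1 : ℤ) else 0) =
          countVec φ w := by
        intro i
        rw [countVec, Finset.sum_apply]
        refine Finset.sum_congr rfl fun u _ => ?_
        have h4 : g' (Sum.inr ⟨φ, i⟩) u = Sum.inl (φ u) := rfl
        rw [h4, Pi.single_apply]
        simp [eq_comm]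
      rw [Finset.sum_congr rfl fun i _ => h3 i]
      simp
    zify at h1 ⊢
    rw [h1, h2]
    ring
  · have h2 : ∑ p : (Σ φ : H →g R, Fin (n φ)), ∑ u,
        (if g' (Sum.inr p) u = Sum.inr x then 1 else 0) = 0 :=
      Finset.sum_eq_zero fun p _ => Finset.sum_eq_zero fun u _ => by simp [g', inlHom]
    rw [h2, add_zero, Finset.sum_eq_single x, Finset.sum_eq_single u₀]
    · simp [g', hψ]
    · intro u _ hu; simp [g', hψ, hu]
    · simp
    · intro x' _ hx
      refine Finset.sum_eq_zero fun u _ => ?_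
      by_cases hu : u = u₀ <;> simp [g', hψ, hx, hu]
    · simp

section

variable {α β : Type*} [Fintype α] [Fintype β] {M N : ℕ}

open Classical in
/-- The deviation from its mean of the number of `P`-related elements in the block `j` to the
element `u` of the block `i`. -/
noncomputable def blockDev (P : β → β → Prop) (e : Fin N × α ≃ β) (u : α) (i j : Fin N) : ℝ :=
  (Finset.univ.filter fun u' => P (e (i, u)) (e (j, u'))).card -
    (Finset.univ.filter fun w => P (e (i, u)) w).card / N

open Classical in
lemma sum_card_block (e : Fin N × α ≃ β) (Q : β → Prop) :
    ∑ j, (Finset.univ.filter fun u' => Q (e (j, u'))).card = (Finset.univ.filter Q).card := by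
  simp only [Finset.card_filter]
  rw [← e.sum_comp, Fintype.sum_prod_type]

lemma sum_blockDev (P : β → β → Prop) (e : Fin N × α ≃ β) (u : α) (i : Fin N) :
    ∑ j, blockDev P e u i j = 0 := by
  classical
  have hN : (N : ℝ) ≠ 0 := by exact_mod_cast (Fin.pos i).ne'
  simp only [blockDev, Finset.sum_sub_distrib, Finset.sum_const, Finset.card_univ,
    Fintype.card_fin, nsmul_eq_mul]
  rw [← Nat.cast_sum, sum_card_block e (P (e (i, u)))]
  field_simp
  simp

lemma abs_blockDev_le (P : β → β → Prop) (e : Fin N × α ≃ β) (u : α) (i j : Fin N) :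
    |blockDev P e u i j| ≤ Fintype.card α := by
  classical
  have hN : (0 : ℝ) < N := by exact_mod_cast Fin.pos i
  have h1 : ((Finset.univ.filter fun u' => P (e (i, u)) (e (j, u'))).card : ℝ) ≤
      Fintype.card α := by exact_mod_cast Finset.card_le_univ _
  have h2 : ((Finset.univ.filter fun w => P (e (i, u)) w).card : ℝ) / N ≤ Fintype.card α := by
    rw [div_le_iff₀ hN]
    have := Finset.card_le_univ (Finset.univ.filter fun w => P (e (i, u)) w)
    rw [← Fintype.card_congr e, Fintype.card_prod, Fintype.card_fin, mul_comm] at this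
    exact_mod_cast this
  have h3 : 0 ≤ ((Finset.univ.filter fun w => P (e (i, u)) w).card : ℝ) / N := by positivity
  rw [blockDev, abs_le]
  constructor <;> linarith [Nat.cast_nonneg (α := ℝ)
    (Finset.univ.filter fun u' => P (e (i, u)) (e (j, u'))).card]

/-- The graph spanned by the blocks of a tuple `f` extended by the block `i₀`, without the edges
inside blocks. -/
def tupleGraph (G : SimpleGraph β) (e : Fin N × α ≃ β) (i₀ : Fin N) (f : Fin M → Fin N) :
    SimpleGraph (Option (Fin M) × α) where
  Adj p q := p.1 ≠ q.1 ∧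
    G.Adj (e (extendTuple i₀ f p.1, p.2)) (e (extendTuple i₀ f q.1, q.2))
  symm := ⟨fun _ _ h => ⟨h.1.symm, h.2.symm⟩⟩
  loopless := ⟨fun _ h => h.1 rfl⟩

/-- The vertices of a tuple graph in blocks of `A`, and those in the additional block. -/
def blockMap (A : Finset (Fin M)) : (A × α) ⊕ α → Option (Fin M) × α :=
  Sum.elim (fun p => (some p.1, p.2)) fun u => (none, u)

/-- The hypotheses of `exists_balanced_homs` for the blocks of `A` and the additional block. -/
def GoodType (Γ : SimpleGraph (Option (Fin M) × α)) (A : Finset (Fin M)) (r : ℕ) (o s η : ℝ) :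
    Prop :=
  DegCond ((Γ.comap (blockMap A)).comap Sum.inl) r o s η ∧
    ∀ u, (((r : ℝ) - 2) * o + η) * Fintype.card (A × α) ≤
      ({w | (Γ.comap (blockMap A)).Adj (Sum.inr u) (Sum.inl w)}.ncard : ℝ)

open Classical in
lemma degN_le_card_tupleGraph_adj (G : SimpleGraph β) (e : Fin N × α ≃ β) (i₀ : Fin N)
    (f : Fin M → Fin N) (A : Finset (Fin M)) {K : ℕ} (hA : M ≤ A.card + K) {δ : ℝ}
    (p : Option (Fin M)) (u : α)
    (hd : |∑ b, blockDev G.Adj e u (extendTuple i₀ f p) (f b)| ≤ δ * M) :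
    (M : ℝ) * degN G (e (extendTuple i₀ f p, u)) / N ≤
      (Finset.univ.filter fun w : A × α =>
        (tupleGraph G e i₀ f).Adj (p, u) (some w.1.1, w.2)).card + δ * M +
        (K + 1) * Fintype.card α := by
  set v := e (extendTuple i₀ f p, u) with hv
  have h1 : ∑ b, blockDev G.Adj e u (extendTuple i₀ f p) (f b) =
      (∑ b, (Finset.univ.filter fun u' => G.Adj v (e (f b, u'))).card : ℕ) -
        (M : ℝ) * degN G v / N := by
    simp only [blockDev, Finset.sum_sub_distrib, Finset.sum_const, Finset.card_univ,
      Fintype.card_fin, nsmul_eq_mul, degN_eq_card_filter, Nat.cast_sum]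
    rw [mul_div_assoc]
  have h2 : ∑ b, (Finset.univ.filter fun u' => G.Adj v (e (f b, u'))).card ≤
      (Finset.univ.filter fun w : A × α =>
        (tupleGraph G e i₀ f).Adj (p, u) (some w.1.1, w.2)).card + (K + 1) * Fintype.card α := by
    have h3 : (Finset.univ.filter fun w : A × α =>
        (tupleGraph G e i₀ f).Adj (p, u) (some w.1.1, w.2)).card =
        ∑ b ∈ A, (Finset.univ.filter fun u' => p ≠ some b ∧ G.Adj v (e (f b, u'))).card := by
      rw [Finset.card_filter, Fintype.sum_prod_type, ← Finset.sum_coe_sort A]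
      refine Finset.sum_congr rfl fun b _ => ?_
      rw [Finset.card_filter]
      exact Finset.sum_congr rfl fun u' _ => if_congr Iff.rfl rfl rfl
    have h4 : ∀ b, (Finset.univ.filter fun u' => G.Adj v (e (f b, u'))).card ≤
        Fintype.card α := fun b => Finset.card_le_univ _
    have h5 : (Finset.univ \ A).card ≤ K := by
      rw [Finset.card_sdiff_of_subset (Finset.subset_univ _), Finset.card_univ, Fintype.card_fin]
      omega
    have h6 : ∑ b ∈ Finset.univ \ A, (Finset.univ.filter fun u' => G.Adj v (e (f b, u'))).card ≤
        K * Fintype.card α :=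
      (Finset.sum_le_card_nsmul _ _ _ fun b _ => h4 b).trans (Nat.mul_le_mul_right _ h5)
    have h7 : ∑ b ∈ A, (Finset.univ.filter fun u' => G.Adj v (e (f b, u'))).card ≤
        ∑ b ∈ A, ((Finset.univ.filter fun u' => p ≠ some b ∧ G.Adj v (e (f b, u'))).card +
          if p = some b then Fintype.card α else 0) := by
      refine Finset.sum_le_sum fun b _ => ?_
      by_cases hb : p = some b
      · simpa [hb] using h4 b
      · simp [hb]
    have h8 : ∑ b ∈ A, (if p = some b then Fintype.card α else 0) ≤ Fintype.card α := by
      cases p with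
      | none => simp
      | some a =>
        simp only [Option.some.injEq, Finset.sum_ite_eq]
        split_ifs <;> simp
    rw [Finset.sum_add_distrib] at h7
    rw [← Finset.sum_sdiff (Finset.subset_univ A), h3]
    linarith
  rw [h1] at hd
  have h9 := (abs_le.mp hd).1
  have h10 : ((∑ b, (Finset.univ.filter fun u' => G.Adj v (e (f b, u'))).card : ℕ) : ℝ) ≤
      (Finset.univ.filter fun w : A × α =>
        (tupleGraph G e i₀ f).Adj (p, u) (some w.1.1, w.2)).card + (K + 1) * Fintype.card α := by
    exact_mod_cast h2
  linarith

lemma goodType_of_blockDev_le {G : SimpleGraph β} {e : Fin N × α ≃ β} {i₀ : Fin N}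
    {f : Fin M → Fin N} {A : Finset (Fin M)} {K : ℕ} {r : ℕ} {o s η : ℝ}
    (hG : DegCond G r o s η) (hr : 2 ≤ r) (hs : 0 < s) (hso : s ≤ o) (hη : 0 < η)
    (hA : M ≤ A.card + K) (hM : ((K : ℝ) + 1) * 4 ≤ η * M)
    (hadj : ∀ p, (∀ a, p = some a → a ∈ A) → ∀ u,
      |∑ b, blockDev G.Adj e u (extendTuple i₀ f p) (f b)| ≤ η * Fintype.card α / 8 * M)
    (hdeg : ∀ p, (∀ a, p = some a → a ∈ A) → ∀ u,
      |∑ b, blockDev (fun v w => degN G w ≤ degN G v) e u (extendTuple i₀ f p) (f b)| ≤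
        η * Fintype.card α / 8 * M) :
    GoodType (tupleGraph G e i₀ f) A r o s (η / 2) := by
  classical
  have hN : (0 : ℝ) < N := by exact_mod_cast Fin.pos i₀
  have ho : 0 < o := hs.trans_le hso
  have hcard : (Fintype.card β : ℝ) = N * Fintype.card α := by
    rw [← Fintype.card_congr e, Fintype.card_prod, Fintype.card_fin]; push_cast; ring
  have hcardA : (Fintype.card (A × α) : ℝ) = A.card * Fintype.card α := by
    rw [Fintype.card_prod, Fintype.card_coe]; push_cast; ring
  have hAM : (A.card : ℝ) ≤ M := by
    exact_mod_cast (Finset.card_le_univ A).trans_eq (Fintype.card_fin M)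
  have hα : (0 : ℝ) ≤ Fintype.card α := Nat.cast_nonneg _
  have hr2 : (0 : ℝ) ≤ (r : ℝ) - 2 := by
    have : (2 : ℝ) ≤ r := by exact_mod_cast hr
    linarith
  have hM' := mul_le_mul_of_nonneg_right hM hα
  have hAα := mul_le_mul_of_nonneg_right hAM hα
  have hAη := mul_le_mul_of_nonneg_left hAα hη.le
  have hAo := mul_le_mul_of_nonneg_left hAα (mul_nonneg hr2 ho.le)
  constructor
  · intro Z hZ
    obtain ⟨z, hzZ, hz⟩ := Finset.exists_max_image Z
      (fun z => degN G (e (f z.1, z.2))) hZ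
    refine ⟨z, hzZ, ?_⟩
    have hp : ∀ a, some z.1.1 = some a → a ∈ A := fun a h => by
      rw [← Option.some_injective _ h]; exact z.1.2
    have h1 := degN_le_card_tupleGraph_adj G e i₀ f A hA (some z.1.1) z.2 (hadj _ hp z.2)
    set v := e (f z.1, z.2) with hv
    change (M : ℝ) * degN G v / N ≤ _ at h1
    have h2 := hdeg _ hp z.2
    let B := Finset.univ.filter fun w => degN G w ≤ degN G v
    obtain ⟨w, hwB, hw⟩ := hG B ⟨v, by simp [B]⟩
    have hwv : (degN G w : ℝ) ≤ degN G v := by exact_mod_cast (Finset.mem_filter.mp hwB).2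
    have h3 : ∑ b, blockDev (fun v w => degN G w ≤ degN G v) e z.2
        (extendTuple i₀ f (some z.1.1)) (f b) =
        (∑ b, (Finset.univ.filter fun u' => degN G (e (f b, u')) ≤ degN G v).card : ℕ) -
        (M : ℝ) * B.card / N := by
      simp only [blockDev, Finset.sum_sub_distrib, Finset.sum_const, Finset.card_univ,
        Fintype.card_fin, nsmul_eq_mul, Nat.cast_sum]
      rw [mul_div_assoc]
      rfl
    have h4 : Z.card ≤
        ∑ b, (Finset.univ.filter fun u' => degN G (e (f b, u')) ≤ degN G v).card := by
      have : ∑ b, (Finset.univ.filter fun u' => degN G (e (f b, u')) ≤ degN G v).card =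
          (Finset.univ.filter fun p : Fin M × α => degN G (e (f p.1, p.2)) ≤ degN G v).card := by
        simp only [Finset.card_filter]
        rw [Fintype.sum_prod_type]
      rw [this]
      refine Finset.card_le_card_of_injOn (fun z => (z.1.1, z.2)) (fun y hy => ?_) ?_
      · simpa using hz y hy
      · rintro ⟨a, b⟩ _ ⟨a', b'⟩ _ h
        simp only [Prod.mk.injEq] at h
        exact Prod.ext (Subtype.ext h.1) h.2
    have h5 : (Z.card : ℝ) ≤ M * B.card / N + η * Fintype.card α / 8 * M := by
      rw [h3] at h2
      have : (Z.card : ℝ) ≤ ((∑ b, (Finset.univ.filter fun u' =>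
        degN G (e (f b, u')) ≤ degN G v).card : ℕ) : ℝ) := by exact_mod_cast h4
      linarith [(abs_le.mp h2).2]
    have h6 : (degN (((tupleGraph G e i₀ f).comap (blockMap A)).comap Sum.inl) z : ℝ) =
        (Finset.univ.filter fun w : A × α =>
        (tupleGraph G e i₀ f).Adj (some z.1.1, z.2) (some w.1.1, w.2)).card := by
      rw [degN_eq_card_filter]
      rfl
    rw [h6, hcardA]
    have h7 : (M : ℝ) * ((((r : ℝ) - 2) * o + η) * Fintype.card α) +
        min (s * (M * Fintype.card α)) (s / o * (M * B.card / N)) ≤ M * degN G v / N := by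
      rw [le_div_iff₀ hN, add_mul, min_mul_of_nonneg _ _ hN.le]
      have := mul_le_mul_of_nonneg_left (hw.trans hwv) (Nat.cast_nonneg (α := ℝ) M)
      rw [hcard, mul_add, mul_min_of_nonneg _ _ (Nat.cast_nonneg (α := ℝ) M)] at this
      convert this using 2
      · ring
      · congr 1
        · ring
        · field_simp
    have hso1 : s / o ≤ 1 := (div_le_one ho).mpr hso
    have hso0 : 0 ≤ s / o := by positivity
    have h8 : min (s * (A.card * Fintype.card α)) (s / o * Z.card) - η * Fintype.card α / 8 * M ≤
        min (s * (M * Fintype.card α)) (s / o * (M * B.card / N)) := by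
      have hδ : 0 ≤ η * Fintype.card α / 8 * M := by positivity
      refine le_min ?_ ?_
      · have := mul_le_mul_of_nonneg_left hAα hs.le
        linarith [min_le_left (s * ((A.card : ℝ) * Fintype.card α)) (s / o * Z.card)]
      · have := mul_le_mul_of_nonneg_left h5 hso0
        have h9 := mul_le_mul_of_nonneg_right hso1 hδ
        linarith [min_le_right (s * ((A.card : ℝ) * Fintype.card α)) (s / o * Z.card)]
    linarith
  · intro u
    have h1 := degN_le_card_tupleGraph_adj G e i₀ f A hA none u (hadj _ (by simp) u)
    have h2 := hG.le_degN hs hso (e (extendTuple i₀ f none, u))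
    have h3 :
        ({w | ((tupleGraph G e i₀ f).comap (blockMap A)).Adj (Sum.inr u) (Sum.inl w)}.ncard : ℝ)
        = (Finset.univ.filter fun w : A × α =>
        (tupleGraph G e i₀ f).Adj (none, u) (some w.1.1, w.2)).card := by
      rw [← Set.ncard_coe_finset]
      congr 2
      ext w
      simp [blockMap]
    rw [h3, hcardA]
    have h4 : (M : ℝ) * ((((r : ℝ) - 2) * o + η) * Fintype.card α) ≤
        M * degN G (e (extendTuple i₀ f none, u)) / N := by
      rw [le_div_iff₀ hN]
      have := mul_le_mul_of_nonneg_left h2 (Nat.cast_nonneg (α := ℝ) M)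
      rw [hcard] at this
      linarith
    have : 0 ≤ η * Fintype.card α * M := by positivity
    linarith

end

section

variable {α β : Type*} [Fintype α] {M N : ℕ}

/-- The blocks in the sets `X a`, for `a ∈ A`, and an additional block. -/
abbrev BlowUp (A : Finset (Fin M)) (X : Fin M → Finset (Fin N)) : Type :=
  (Σ a : A, X a) ⊕ Unit

/-- The position of a block of a blow-up in the extended tuple. -/
def BlowUp.position {A : Finset (Fin M)} {X : Fin M → Finset (Fin N)} (b : BlowUp A X) :
    Option (Fin M) :=
  b.elim (fun p => some p.1) fun _ => none

/-- The index of a block of a blow-up. -/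
def BlowUp.index {A : Finset (Fin M)} {X : Fin M → Finset (Fin N)} (i₀ : Fin N)
    (b : BlowUp A X) : Fin N :=
  b.elim (fun p => p.2) fun _ => i₀

lemma BlowUp.index_injective {A : Finset (Fin M)} {X : Fin M → Finset (Fin N)} {i₀ : Fin N}
    (hX : Pairwise fun a b => Disjoint (X a) (X b)) (hi₀ : ∀ a, i₀ ∉ X a) :
    Function.Injective (BlowUp.index (A := A) (X := X) i₀) := by
  rintro (⟨a, i, hi⟩ | ⟨⟩) (⟨a', i', hi'⟩ | ⟨⟩) h
  · simp only [BlowUp.index, Sum.elim_inl] at h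
    subst h
    have : a = a' := by
      by_contra hne
      exact Finset.disjoint_left.mp (hX fun h => hne (Subtype.ext h)) hi hi'
    subst this
    rfl
  · simp only [BlowUp.index, Sum.elim_inl, Sum.elim_inr] at h
    exact (hi₀ _ (h ▸ hi)).elim
  · simp only [BlowUp.index, Sum.elim_inl, Sum.elim_inr] at h
    exact (hi₀ _ (h ▸ hi')).elim
  · rfl

lemma BlowUp.exists_tuple {A : Finset (Fin M)} {X : Fin M → Finset (Fin N)} {i₀ : Fin N}
    (hX : ∀ a, (X a).Nonempty) (b b' : BlowUp A X) (hb : b.position ≠ b'.position) :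
    ∃ f : Fin M → Fin N, (∀ a, f a ∈ X a) ∧ extendTuple i₀ f b.position = b.index i₀ ∧
      extendTuple i₀ f b'.position = b'.index i₀ := by
  classical
  have one : ∀ (f : Fin M → Fin N), (∀ a, f a ∈ X a) → ∀ b : BlowUp A X,
      ∃ f' : Fin M → Fin N, (∀ a, f' a ∈ X a) ∧ extendTuple i₀ f' b.position = b.index i₀ ∧
        ∀ p, p ≠ b.position → extendTuple i₀ f' p = extendTuple i₀ f p := by
    rintro f hf (⟨a, i, hi⟩ | ⟨⟩)
    · refine ⟨Function.update f a i, fun a' => ?_, ?_, fun p hp => ?_⟩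
      · by_cases h : a' = a
        · subst h; simpa using hi
        · simpa [h] using hf a'
      · simp [extendTuple, BlowUp.position, BlowUp.index]
      · cases p with
        | none => rfl
        | some a' =>
          have : a' ≠ a := fun h => hp (by simp [BlowUp.position, h])
          simp [extendTuple, this]
    · exact ⟨f, hf, rfl, fun _ _ => rfl⟩
  choose f₀ hf₀ using hX
  obtain ⟨f₁, hf₁, h₁, -⟩ := one f₀ hf₀ b
  obtain ⟨f₂, hf₂, h₂, h₃⟩ := one f₁ hf₁ b'
  exact ⟨f₂, hf₂, (h₃ _ hb).trans h₁, h₂⟩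

/-- If all tuples in a grid have the same graph, then a balanced family of homomorphisms into this
graph yields a perfect tiling of the blocks of the grid together with the additional block. -/
lemma exists_blowUp_tiling {H : SimpleGraph α} {G : SimpleGraph β} {e : Fin N × α ≃ β} {i₀ : Fin N}
    {A : Finset (Fin M)} {X : Fin M → Finset (Fin N)} {t : ℕ} (ht : 0 < t)
    (hXt : ∀ a, (X a).card = t) {Γ : SimpleGraph (Option (Fin M) × α)}
    (hΓ : ∀ f : Fin M → Fin N, (∀ a, f a ∈ X a) → tupleGraph G e i₀ f = Γ) {k : ℕ}
    (g : Fin k → (H →g Γ.comap (blockMap A)))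
    (hgl : ∀ w, Nat.card {p : Fin k × α // g p.1 p.2 = Sum.inl w} = t)
    (hgr : ∀ x, Nat.card {p : Fin k × α // g p.1 p.2 = Sum.inr x} = 1) :
    ∃ F : Fin k × α ≃ BlowUp A X × α, ∀ q u v, H.Adj u v →
      G.Adj (e ((F (q, u)).1.index i₀, (F (q, u)).2))
        (e ((F (q, v)).1.index i₀, (F (q, v)).2)) := by
  let τ : BlowUp A X × α → (A × α) ⊕ α := fun p =>
    p.1.elim (fun q => Sum.inl (q.1, p.2)) fun _ => Sum.inr p.2
  have hτ : ∀ p, blockMap A (τ p) = (p.1.position, p.2) := by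
    rintro ⟨_ | _, u⟩ <;> rfl
  have hfib : ∀ y, Nat.card {p : Fin k × α // g p.1 p.2 = y} = Nat.card {p // τ p = y} := by
    rintro (⟨a, u⟩ | u)
    · have h1 : Nat.card (X a) = t := by rw [Nat.card_eq_fintype_card, Fintype.card_coe, hXt]
      rw [hgl, ← h1]
      refine Nat.card_eq_of_bijective
        (fun i : X a => (⟨(Sum.inl ⟨a, i⟩, u), rfl⟩ : {p // τ p = Sum.inl (a, u)})) ⟨?_, ?_⟩
      · intro i j h
        have h2 := congrArg Prod.fst (congrArg Subtype.val h)
        simpa using h2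
      · rintro ⟨⟨⟨a', i⟩ | _, v⟩, h⟩
        · obtain ⟨rfl, rfl⟩ : a' = a ∧ v = u := by simpa [τ] using h
          exact ⟨i, rfl⟩
        · simp [τ] at h
    · rw [hgr]
      symm
      rw [Nat.card_eq_one_iff_unique]
      have huniq : ∀ p : {p // τ p = Sum.inr u}, p = ⟨(Sum.inr (), u), rfl⟩ := by
        rintro ⟨⟨_ | _, v⟩, h⟩
        · simp [τ] at h
        · obtain rfl : v = u := by simpa [τ] using h
          rfl
      exact ⟨⟨fun p q => (huniq p).trans (huniq q).symm⟩, ⟨⟨(Sum.inr (), u), rfl⟩⟩⟩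
  let F : Fin k × α ≃ BlowUp A X × α :=
    Equiv.ofFiberEquiv fun y => Nonempty.some (Finite.card_eq.mp (hfib y))
  have hF : ∀ p, τ (F p) = g p.1 p.2 := fun p =>
    Equiv.ofFiberEquiv_map (f := fun p : Fin k × α => g p.1 p.2) (g := τ) _ p
  refine ⟨F, fun q u v huv => ?_⟩
  have h1 : Γ.Adj (blockMap A (τ (F (q, u)))) (blockMap A (τ (F (q, v)))) := by
    rw [hF, hF]
    exact (g q).map_adj huv
  rw [hτ, hτ] at h1
  have hX : ∀ a, (X a).Nonempty := fun a => Finset.card_pos.mp (by rw [hXt]; exact ht)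
  have hne : (F (q, u)).1.position ≠ (F (q, v)).1.position := by
    obtain ⟨f⟩ : Nonempty (∀ a, X a) := ⟨fun a => ⟨_, (hX a).choose_spec⟩⟩
    rw [← hΓ (fun a => f a) fun a => (f a).2] at h1
    exact h1.1
  obtain ⟨f, hf, hf₁, hf₂⟩ := BlowUp.exists_tuple (i₀ := i₀) hX _ _ hne
  rw [← hΓ f hf] at h1
  have h2 := h1.2
  simp only [hf₁, hf₂] at h2
  exact h2

end

/-- In a graph satisfying the degree condition whose vertices are partitioned into blocks, any
block lies in a union of blocks with a perfect tiling. -/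
lemma DegCond.exists_block_tiling {α : Type*} [Fintype α] [Nonempty α] {H : SimpleGraph α} {r : ℕ}
    {o s η : ℝ} (hr : 2 ≤ r) (hs : 0 < s) (hso : s ≤ o) (hsum : ((r : ℝ) - 1) * o + s = 1)
    (hη : 0 < η) (hH : HcfOne H r) (c : H.Coloring (Fin r)) (i₁ : Fin r)
    (hc : s * Fintype.card α = ((Finset.univ.filter fun u => c u = i₁).card : ℝ)) :
    ∃ N₀ : ℕ, ∀ N ≥ N₀, ∀ (β : Type*) [Fintype β] (G : SimpleGraph β), DegCond G r o s η →
      ∀ (e : Fin N × α ≃ β) (i₀ : Fin N), ∃ (B : Type) (_ : Fintype B) (j : B → Fin N) (k : ℕ)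
        (F : Fin k × α ≃ B × α), Function.Injective j ∧ i₀ ∈ Set.range j ∧ ∀ q u v, H.Adj u v →
          G.Adj (e (j (F (q, u)).1, (F (q, u)).2)) (e (j (F (q, v)).1, (F (q, v)).2)) := by
  classical
  have hα : (0 : ℝ) < Fintype.card α := by exact_mod_cast Fintype.card_pos
  set h := (Fintype.card α : ℝ)
  obtain ⟨K, hK⟩ := exists_nat_ge (4 * (Fintype.card (Bool × α) : ℝ) * h ^ 2 / (η * h / 8) ^ 2)
  obtain ⟨M₀, hM₀⟩ := exists_nat_ge (((K : ℝ) + 1) * 4 / η)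
  let M := M₀ + K + 1
  have hM : ((K : ℝ) + 1) * 4 ≤ η * M := by
    rw [div_le_iff₀ hη] at hM₀
    have : (0 : ℝ) ≤ η * (K + 1) := by positivity
    simp only [M]
    push_cast
    linarith
  have htype : ∀ (Γ : SimpleGraph (Option (Fin M) × α)) (A : Finset (Fin M)), ∃ t₀ : ℕ,
      A.Nonempty → GoodType Γ A r o s (η / 2) → ∀ t ≥ t₀, ∃ (k : ℕ)
      (g : Fin k → (H →g Γ.comap (blockMap A))),
      (∀ w, Nat.card {p : Fin k × α // g p.1 p.2 = Sum.inl w} = t) ∧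
      ∀ x, Nat.card {p : Fin k × α // g p.1 p.2 = Sum.inr x} = 1 := by
    intro Γ A
    by_cases hA : A.Nonempty ∧ GoodType Γ A r o s (η / 2)
    · have : Nonempty A := hA.1.to_subtype
      obtain ⟨t₀, ht₀⟩ := exists_balanced_homs (Γ.comap (blockMap A)) hA.2.1 hr hs hso hsum
        (half_pos hη) hH c i₁ hc hA.2.2 (by rw [Fintype.card_prod]; exact dvd_mul_left _ _) dvd_rfl
      exact ⟨t₀, fun _ _ => ht₀⟩
    · exact ⟨0, fun h1 h2 => (hA ⟨h1, h2⟩).elim⟩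
  choose t₀ ht₀ using htype
  let : Fintype (SimpleGraph (Option (Fin M) × α)) := Fintype.ofFinite _
  let t := ∑ Γ, ∑ A, t₀ Γ A + 1
  have ht : ∀ Γ A, t₀ Γ A ≤ t := fun Γ A =>
    (Finset.single_le_sum (fun _ _ => Nat.zero_le _) (Finset.mem_univ A)).trans
      ((Finset.single_le_sum (f := fun Γ => ∑ A, t₀ Γ A) (fun _ _ => Nat.zero_le _)
        (Finset.mem_univ Γ)).trans (Nat.le_succ _))
  let T : ℕ := Fintype.card (SimpleGraph (Option (Fin M) × α))
  have hT : (0 : ℝ) < T := by exact_mod_cast Fintype.card_pos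
  obtain ⟨N₀, hN₀⟩ := exists_grid_of_dense t M (1 / (2 * T)) (by positivity) 1
  refine ⟨N₀, fun N hN β _ G hG e i₀ => ?_⟩
  have hNpos : (0 : ℝ) < N := by exact_mod_cast Fin.pos i₀
  let good : Finset (Fin M → Fin N) := Finset.univ.filter fun f =>
    ∃ A : Finset (Fin M), A.Nonempty ∧ GoodType (tupleGraph G e i₀ f) A r o s (η / 2)
  let P : Bool → β → β → Prop := fun b => b.casesOn G.Adj fun v w => degN G w ≤ degN G v
  have hgood : 1 / 2 * (N : ℝ) ^ M ≤ good.card := by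
    refine card_good_tuples_ge (fun q : Bool × α => blockDev (P q.1) e q.2) h
      (fun q i j => abs_blockDev_le _ _ _ _ _) (fun q i => sum_blockDev _ _ _ _) i₀ (η * h / 8)
      (by positivity) K (hK.trans (by linarith)) (by simp only [M]; omega) good fun f A hA hf => ?_
    refine Finset.mem_filter.mpr ⟨Finset.mem_univ _, A,
      Finset.card_pos.mp (by simp only [M] at hA; omega), ?_⟩
    exact goodType_of_blockDev_le hG hr hs hso hη hA hM (fun p hp u => hf (false, u) p hp)
      fun p hp u => hf (true, u) p hp
  obtain ⟨Γ, -, hΓ⟩ := Finset.exists_le_card_fiber_of_nsmul_le_card_of_maps_to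
    (s := good) (t := Finset.univ) (f := tupleGraph G e i₀) (b := 1 / (2 * T) * (N : ℝ) ^ M)
    (fun _ _ => Finset.mem_univ _) Finset.univ_nonempty (by
      rw [Finset.card_univ, nsmul_eq_mul]
      refine le_trans (le_of_eq ?_) hgood
      change (T : ℝ) * _ = _
      field_simp)
  have hne : (good.filter fun f => tupleGraph G e i₀ f = Γ).Nonempty := by
    rw [← Finset.card_pos]
    have : (0 : ℝ) < 1 / (2 * T) * (N : ℝ) ^ M := by positivity
    exact_mod_cast this.trans_le hΓ
  obtain ⟨f₀, hf₀⟩ := hne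
  obtain ⟨hf₁, rfl⟩ := Finset.mem_filter.mp hf₀
  obtain ⟨A, hAne, hA⟩ := (Finset.mem_filter.mp hf₁).2
  obtain ⟨X, hXt, hXi, hXd, hX⟩ := hN₀ N hN _ hΓ {i₀} (by simp)
  obtain ⟨k, g, hgl, hgr⟩ := ht₀ _ _ hAne hA t (ht _ _)
  obtain ⟨F, hF⟩ := exists_blowUp_tiling (Nat.succ_pos _) hXt
    (fun f hf => (Finset.mem_filter.mp (hX f hf)).2) g hgl hgr
  exact ⟨BlowUp A X, inferInstance, BlowUp.index i₀, k, F,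
    BlowUp.index_injective hXd fun a => Finset.disjoint_singleton_right.mp (hXi a),
    ⟨Sum.inr (), rfl⟩, hF⟩

/-- `F` is a family of vertex-disjoint copies of `H` in `G`, indexed by `ι`. -/
def IsTileFamily {α β ι : Type*} (H : SimpleGraph α) (G : SimpleGraph β) (F : ι × α → β) : Prop :=
  Function.Injective F ∧ ∀ i u v, H.Adj u v → G.Adj (F (i, u)) (F (i, v))

section

variable {α β : Type*} [Fintype α] {H : SimpleGraph α} {G : SimpleGraph β} {N : ℕ}

lemma IsTileFamily.card_le [Fintype β] [Nonempty α] {ι : Type*} [Fintype ι] {F : ι × α → β}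
    (hF : IsTileFamily H G F) (hβ : Fintype.card β = N * Fintype.card α) : Fintype.card ι ≤ N := by
  have := Fintype.card_le_of_injective F hF.1
  rw [Fintype.card_prod, hβ] at this
  exact Nat.le_of_mul_le_mul_right this Fintype.card_pos

lemma IsTileFamily.hasPerfectTiling [Fintype β] [Nonempty α] {F : Fin N × α → β}
    (hF : IsTileFamily H G F)
    (hβ : Fintype.card β = N * Fintype.card α) : HasPerfectTiling H G := by
  have hsurj : Function.Surjective F :=
    ((Fintype.bijective_iff_injective_and_card F).mpr ⟨hF.1, by simp [hβ]⟩).2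
  refine ⟨Set.range fun i u => F (i, u), ⟨?_, ?_⟩, fun v => ?_⟩
  · rintro _ ⟨i, rfl⟩
    exact ⟨fun u v h => congrArg Prod.snd (hF.1 h), fun u v h => hF.2 i u v h⟩
  · rintro _ ⟨i, rfl⟩ _ ⟨i', rfl⟩ hne
    refine Set.disjoint_left.mpr ?_
    rintro _ ⟨u, rfl⟩ ⟨u', h⟩
    have : i' = i := congrArg Prod.fst (hF.1 h)
    exact hne (by rw [this])
  · obtain ⟨⟨i, u⟩, rfl⟩ := hsurj v
    exact ⟨_, ⟨i, rfl⟩, u, rfl⟩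

lemma exists_equiv_extending [Fintype β] {k : ℕ} {F : Fin k × α → β} (hF : Function.Injective F)
    (hβ : Fintype.card β = N * Fintype.card α) :
    ∃ e : Fin N × α ≃ β, ∀ (i : Fin N) (hi : (i : ℕ) < k) u, e (i, u) = F (⟨i, hi⟩, u) := by
  classical
  have e₀ : Fin N × α ≃ β := Fintype.equivOfCardEq (by simp [hβ])
  let f : Fin N × α → β := fun p => if h : (p.1 : ℕ) < k then F (⟨p.1, h⟩, p.2) else e₀ p
  obtain ⟨g, hg⟩ := Finset.exists_equiv_extend_of_card_eq (α := Fin N × α)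
    (t := (Finset.univ : Finset β))
    (by simp [hβ]) (s := Finset.univ.filter fun p => (p.1 : ℕ) < k) (f := f)
    (Finset.subset_univ _) (by
      rintro ⟨i, u⟩ hi ⟨i', u'⟩ hi' h
      have hi : (i : ℕ) < k := by simpa using hi
      have hi' : (i' : ℕ) < k := by simpa using hi'
      simp only [f, dif_pos hi, dif_pos hi'] at h
      have := hF h
      simp only [Prod.mk.injEq, Fin.mk.injEq] at this
      exact Prod.ext (Fin.ext this.1) this.2)
  refine ⟨g.trans (Equiv.subtypeUnivEquiv fun _ => Finset.mem_univ _), fun i hi u => ?_⟩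
  have := hg (i, u) (by simpa using hi)
  simp only [f, dif_pos hi] at this
  exact this

/-- Retiling a union of blocks that contains a block outside the tiling increases the tiling. -/
lemma exists_larger_tileFamily [Nonempty α] {k : ℕ} {e : Fin N × α ≃ β} {i₀ : Fin N}
    (hi₀ : k ≤ (i₀ : ℕ)) (he : ∀ i : Fin N, (i : ℕ) < k → ∀ u v, H.Adj u v →
      G.Adj (e (i, u)) (e (i, v))) {B : Type} [Fintype B] {j : B → Fin N}
    (hj : Function.Injective j) (hi₀j : i₀ ∈ Set.range j) {k' : ℕ} (F : Fin k' × α ≃ B × α)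
    (hF : ∀ q u v, H.Adj u v →
      G.Adj (e (j (F (q, u)).1, (F (q, u)).2)) (e (j (F (q, v)).1, (F (q, v)).2))) :
    ∃ k₁ > k, ∃ F₁ : Fin k₁ × α → β, IsTileFamily H G F₁ := by
  classical
  let S := {i : Fin N // (i : ℕ) < k ∧ i ∉ Set.range j}
  have hB : k' = Fintype.card B := by
    have := Fintype.card_congr F
    rw [Fintype.card_prod, Fintype.card_prod, Fintype.card_fin] at this
    exact Nat.eq_of_mul_eq_mul_right Fintype.card_pos this
  let F₂ : (Fin k' ⊕ S) × α → β := fun p =>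
    p.1.elim (fun q => e (j (F (q, p.2)).1, (F (q, p.2)).2)) fun i => e (i.1, p.2)
  let c := Fintype.equivFin (Fin k' ⊕ S)
  refine ⟨Fintype.card (Fin k' ⊕ S), ?_, fun p => F₂ (c.symm p.1, p.2), ?_, ?_⟩
  · rw [Fintype.card_sum, Fintype.card_fin, hB, Fintype.card_subtype]
    have h1 : (Finset.univ.filter fun i : Fin N => (i : ℕ) < k) ⊆
        (Finset.univ.filter fun i : Fin N => (i : ℕ) < k ∧ i ∉ Set.range j) ∪
          (Finset.univ.image j).erase i₀ := by
      intro i hi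
      have hi : (i : ℕ) < k := by simpa using hi
      by_cases hij : i ∈ Set.range j
      · refine Finset.mem_union_right _ (Finset.mem_erase.mpr ⟨?_, by simpa using hij⟩)
        rintro rfl
        omega
      · exact Finset.mem_union_left _ (by simpa [hi] using hij)
    have h2 : (Finset.univ.filter fun i : Fin N => (i : ℕ) < k).card = k := by
      rw [Fin.card_filter_val_lt]
      have := i₀.2
      omega
    have h3 := (Finset.card_le_card h1).trans (Finset.card_union_le _ _)
    rw [h2, Finset.card_erase_of_mem (by simpa using hi₀j), Finset.card_image_of_injective _ hj,
      Finset.card_univ] at h3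
    have : 0 < Fintype.card B := Fintype.card_pos_iff.mpr ⟨hi₀j.choose⟩
    omega
  · have hF₂ : Function.Injective F₂ := by
      rintro ⟨q | i, u⟩ ⟨q' | i', u'⟩ h
      · have := e.injective h
        simp only [Prod.mk.injEq] at this
        have := F.injective (Prod.ext (hj this.1) this.2)
        simp only [Prod.mk.injEq] at this
        rw [this.1, this.2]
      · have := congrArg Prod.fst (e.injective h)
        exact (i'.2.2 ⟨_, this⟩).elim
      · have := congrArg Prod.fst (e.injective h)
        exact (i.2.2 ⟨_, this.symm⟩).elim
      · have := e.injective h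
        simp only [Prod.mk.injEq] at this
        rw [Subtype.ext this.1, this.2]
    rintro ⟨q, u⟩ ⟨q', u'⟩ h
    have := hF₂ h
    simpa using this
  · intro q u v huv
    rcases h : c.symm q with q' | i
    · simpa [h, F₂] using hF q' u v huv
    · simpa [h, F₂] using he i.1 i.2.1 u v huv

end

/-- A large graph satisfying the degree condition has a perfect tiling. -/
lemma DegCond.hasPerfectTiling {α : Type*} [Fintype α] [Nonempty α] {H : SimpleGraph α} {r : ℕ}
    {o s η : ℝ} (hr : 2 ≤ r) (hs : 0 < s) (hso : s ≤ o) (hsum : ((r : ℝ) - 1) * o + s = 1)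
    (hη : 0 < η) (hH : HcfOne H r) (c : H.Coloring (Fin r)) (i₁ : Fin r)
    (hc : s * Fintype.card α = ((Finset.univ.filter fun u => c u = i₁).card : ℝ)) :
    ∃ N₀ : ℕ, ∀ N ≥ N₀, ∀ (β : Type*) [Fintype β] (G : SimpleGraph β), DegCond G r o s η →
      Fintype.card β = N * Fintype.card α → HasPerfectTiling H G := by
  classical
  obtain ⟨N₀, hN₀⟩ := DegCond.exists_block_tiling hr hs hso hsum hη hH c i₁ hc
  refine ⟨N₀, fun N hN β _ G hG hβ => ?_⟩
  let P : ℕ → Prop := fun k => ∃ F : Fin k × α → β, IsTileFamily H G F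
  have hP : P (Nat.findGreatest P N) := Nat.findGreatest_spec (Nat.zero_le N)
    ⟨fun p => p.1.elim0, fun p => p.1.elim0, fun i => i.elim0⟩
  rcases (Nat.findGreatest_le (P := P) N).eq_or_lt with h | h
  · rw [h] at hP
    exact hP.choose_spec.hasPerfectTiling hβ
  · obtain ⟨F, hF⟩ := hP
    obtain ⟨e, he⟩ := exists_equiv_extending hF.1 hβ
    obtain ⟨B, _, j, k, F', hj, hi₀, hF'⟩ := hN₀ N hN β G hG e ⟨_, h⟩
    obtain ⟨k₁, hk₁, F₁, hF₁⟩ := exists_larger_tileFamily (le_refl (Nat.findGreatest P N))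
      (fun i hi u v huv => by rw [he i hi, he i hi]; exact hF.2 _ u v huv) hj hi₀ F' hF'
    have hk₁N : k₁ ≤ N := by simpa using hF₁.card_le hβ
    exact (Nat.findGreatest_is_greatest hk₁ hk₁N ⟨F₁, hF₁⟩).elim

lemma degCond_of_degree_sequence {β : Type*} [Fintype β] {G : SimpleGraph β} {r n : ℕ}
    {o s η : ℝ} (hs : 0 < s) (hso : s ≤ o) (hβ : Fintype.card β = n) (hn : 2 / η ≤ n)
    (hη : 0 < η) (hno : 1 / o ≤ n) (e : Fin n ≃ β)
    (hmono : ∀ i j : Fin n, i ≤ j → degN G (e i) ≤ degN G (e j))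
    (hdeg : ∀ i : Fin n, ((i : ℕ) + 1 : ℝ) ≤ o * n →
      ((r : ℝ) - 2) * o * n + s / o * ((i : ℕ) + 1) + η * n ≤ (degN G (e i) : ℝ)) :
    DegCond G r o s (η / 2) := by
  classical
  have ho := hs.trans_le hso
  rw [div_le_iff₀ hη] at hn
  rw [div_le_iff₀ ho] at hno
  intro Z hZ
  have hZpos := Finset.card_pos.mpr hZ
  have hZn : Z.card ≤ n := hβ ▸ Finset.card_le_univ Z
  obtain ⟨i, hiZ, hi⟩ : ∃ i : Fin n, e i ∈ Z ∧ Z.card ≤ (i : ℕ) + 1 := by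
    by_contra! hlt
    have h1 : Z ⊆ (Finset.univ.filter fun i : Fin n => (i : ℕ) < Z.card - 1).image e := by
      intro v hv
      refine Finset.mem_image.mpr ⟨e.symm v, ?_, e.apply_symm_apply v⟩
      have := hlt (e.symm v) (by simpa using hv)
      simp only [Finset.mem_filter, Finset.mem_univ, true_and]
      omega
    have h2 := (Finset.card_le_card h1).trans Finset.card_image_le
    rw [Fin.card_filter_val_lt] at h2
    omega
  have hfl : 1 ≤ ⌊o * n⌋₊ := Nat.le_floor (by push_cast; linarith)
  obtain ⟨J, hJ1, hJZ, hJo, hJ⟩ : ∃ J : ℕ, 1 ≤ J ∧ J ≤ Z.card ∧ (J : ℝ) ≤ o * n ∧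
      min (s * n) (s / o * Z.card) ≤ s / o * J + 1 := by
    have hso0 : 0 ≤ s / o := by positivity
    rcases le_total Z.card ⌊o * n⌋₊ with h | h
    · exact ⟨Z.card, hZpos, le_rfl, (Nat.cast_le.mpr h).trans (Nat.floor_le (by positivity)),
        (min_le_right _ _).trans (by linarith)⟩
    · refine ⟨⌊o * n⌋₊, hfl, h, Nat.floor_le (by positivity), (min_le_left _ _).trans ?_⟩
      have h1 := mul_le_mul_of_nonneg_left (Nat.lt_floor_add_one (o * n)).le hso0
      have h2 : s / o * (o * n) = s * n := by field_simp
      have h3 : s / o ≤ 1 := (div_le_one ho).mpr hso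
      linarith
  let j : Fin n := ⟨J - 1, by omega⟩
  have hj : ((j : ℕ) + 1 : ℝ) = J := by
    have : (j : ℕ) + 1 = J := by simp only [j]; omega
    exact_mod_cast this
  have h1 := hdeg j (by rw [hj]; exact hJo)
  rw [hj] at h1
  have h2 : (degN G (e j) : ℝ) ≤ degN G (e i) := by
    refine Nat.cast_le.mpr (hmono j i (Fin.le_def.mpr ?_))
    simp only [j]
    omega
  refine ⟨e i, hiZ, ?_⟩
  rw [hβ]
  linarith

lemma exists_coloring_card_eq_minClassSize {α : Type*} [Fintype α] {H : SimpleGraph α} {r : ℕ}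
    (hr : 0 < r) (hchi : H.chromaticNumber = (r : ℕ∞)) :
    0 < minClassSize H r ∧ r * minClassSize H r ≤ Fintype.card α ∧
      ∃ (c : H.Coloring (Fin r)) (i : Fin r), (Finset.univ.filter fun u => c u = i).card =
        minClassSize H r := by
  have hset : ∀ (c : H.Coloring (Fin r)) (i : Fin r),
      {v | c v = i}.ncard = (Finset.univ.filter fun u => c u = i).card := fun c i => by
    rw [← Set.ncard_coe_finset]
    congr 1
    ext
    simp
  obtain ⟨c₀⟩ : H.Colorable r := SimpleGraph.chromaticNumber_le_iff_colorable.mp hchi.le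
  obtain ⟨c, i, hci⟩ := Nat.sInf_mem (s := {s : ℕ | ∃ (c : H.Coloring (Fin r)) (i : Fin r),
    s = {v | c v = i}.ncard}) ⟨_, c₀, ⟨0, hr⟩, rfl⟩
  change minClassSize H r = _ at hci
  rw [hset] at hci
  refine ⟨?_, ?_, c, i, hci.symm⟩
  · obtain ⟨u, hu⟩ := SimpleGraph.le_chromaticNumber_iff_forall_surjective.mp hchi.ge c i
    rw [hci]
    exact Finset.card_pos.mpr ⟨u, by simpa using hu⟩
  · have h1 : ∀ j ∈ Finset.univ, minClassSize H r ≤ (Finset.univ.filter fun u => c u = j).card :=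
      fun j _ => (hset c j) ▸ Nat.sInf_le ⟨c, j, rfl⟩
    have h2 := Finset.card_nsmul_le_sum _ _ _ h1
    rw [← Finset.card_eq_sum_card_fiberwise (fun _ _ => Finset.mem_univ _)] at h2
    simpa using h2

/-- Theorem 1.6: degree sequence version of the Kühn–Osthus theorem
for graphs `H` with `hcf(H) = 1`. -/
theorem kuhnOsthus_degreeSequence
    {α : Type*} [Fintype α] (H : SimpleGraph α) (r : ℕ)
    (hr : 2 ≤ r) (hchi : H.chromaticNumber = (r : ℕ∞)) (hhcf : HcfOne H r)
    (σ ω h : ℝ) (hσ : σ = (minClassSize H r : ℝ)) (hh : h = (Fintype.card α : ℝ))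
    (hω : ω = (h - σ) / ((r : ℝ) - 1))
    (η : ℝ) (hη : 0 < η) :
    ∃ n₁ : ℕ, ∀ (β : Type) [Fintype β] (G : SimpleGraph β) (n : ℕ),
      Fintype.card β = n → n₁ ≤ n → Fintype.card α ∣ n →
      (∃ e : Fin n ≃ β,
        (∀ i j : Fin n, i ≤ j → degN G (e i) ≤ degN G (e j)) ∧
        (∀ i : Fin n, ((i : ℕ) + 1 : ℝ) ≤ ω * n / h →
          (1 - (ω + σ) / h) * n + (σ / ω) * ((i : ℕ) + 1) + η * n ≤ (degN G (e i) : ℝ))) →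
      HasPerfectTiling H G := by
  obtain ⟨hσ0, hσh, c, i₁, hc⟩ := exists_coloring_card_eq_minClassSize (by omega) hchi
  have hα : 0 < Fintype.card α := lt_of_lt_of_le (by positivity) hσh
  have : Nonempty α := Fintype.card_pos_iff.mp hα
  have hσ1 : 0 < σ := by rw [hσ]; exact_mod_cast hσ0
  have hh1 : 0 < h := by rw [hh]; exact_mod_cast hα
  have hr1 : (0 : ℝ) < (r : ℝ) - 1 := by
    have : (2 : ℝ) ≤ r := by exact_mod_cast hr
    linarith
  have hω1 : ((r : ℝ) - 1) * ω = h - σ := by rw [hω]; field_simp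
  have hσω : σ ≤ ω := by
    have : (r : ℝ) * σ ≤ h := by rw [hσ, hh]; exact_mod_cast hσh
    rw [hω, le_div_iff₀ hr1]
    linarith
  have hω0 := hσ1.trans_le hσω
  have hs : 0 < σ / h := div_pos hσ1 hh1
  have hso : σ / h ≤ ω / h := div_le_div_of_nonneg_right hσω hh1.le
  have hsum : ((r : ℝ) - 1) * (ω / h) + σ / h = 1 := by
    rw [← mul_div_assoc, hω1]
    field_simp
    ring
  obtain ⟨N₀, hN₀⟩ := DegCond.hasPerfectTiling hr hs hso hsum (half_pos hη) hhcf c i₁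
    (by rw [hc, ← hh, ← hσ]; field_simp)
  refine ⟨N₀ * Fintype.card α + ⌈2 / η⌉₊ + ⌈1 / (ω / h)⌉₊, fun β _ G n hβ hn hdvd => ?_⟩
  rintro ⟨e, hmono, hdeg⟩
  have hG : DegCond G r (ω / h) (σ / h) (η / 2) := by
    refine degCond_of_degree_sequence hs hso hβ (Nat.ceil_le.mp (by omega)) hη
      (Nat.ceil_le.mp (by omega)) e hmono fun i hi => ?_
    refine le_trans (le_of_eq ?_) (hdeg i (by rwa [mul_div_right_comm]))
    have h1 : 1 - (ω + σ) / h = ((r : ℝ) - 2) * (ω / h) := by rw [← hsum]; ring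
    rw [h1, div_div_div_cancel_right₀ hh1.ne']
  obtain ⟨N, rfl⟩ := hdvd
  refine hN₀ N ?_ β G hG (by rw [hβ, mul_comm])
  refine Nat.le_of_mul_le_mul_right (c := Fintype.card α) ?_ hα
  rw [mul_comm N]
  omega
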